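/- arXiv:2506.17737 — 2 statements merged into one kernel-verified Lean document; each statement's English description precedes it below -/
import Mathlib

section
/- Let 0 < a < 1/2 and k ≥ 1. Then dim_H D^{±∞}_{k,a} = d(a). If k is even, then dim_H D^{+∞}_{k,a} = d(a). If k is odd, then: (a) for 0 < a < 1/3, dim_H D^{+∞}_{k,a} = d(a) > d̃(a) = dim_H D^{−∞}_{k,a}; (b) for a = 1/3, dim_H D^{+∞}_{k,a} = dim_H D^{−∞}_{k,a} = 1; (c) for 1/3 < a < 1/2, dim_H D^{+∞}_{k,a} = d̃(a) < d(a) = dim_H D^{−∞}_{k,a}. -/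
open Filter Topology MeasureTheory Set
open scoped ENNReal

/-- The `(n+1)`-th ternary digit of `x` (choosing the expansion ending in all `0`s
when two expansions exist, and the all-`2`s expansion for `x = 1`). -/
noncomputable def tDigit (x : ℝ) (n : ℕ) : ℕ :=
  if x = 1 then 2 else (⌊(3:ℝ) ^ (n + 1) * x⌋ - 3 * ⌊(3:ℝ) ^ n * x⌋).toNat

/-- `l_n(x)`: the number of `1`s among the first `n` ternary digits of `x`. -/
noncomputable def lCount (x : ℝ) (n : ℕ) : ℕ :=
  ((Finset.range n).filter (fun i => tDigit x i = 1)).card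

/-- `q_a(d)` with `q_a(0)=0`, `q_a(1)=a`, `q_a(2)=1-a`. -/
noncomputable def qDig (a : ℝ) (d : ℕ) : ℝ :=
  if d = 0 then 0 else if d = 1 then a else 1 - a

/-- Okamoto's function `F_a`. -/
noncomputable def Okamoto (a x : ℝ) : ℝ :=
  ∑' n : ℕ, a ^ (n - lCount x n) * (1 - 2 * a) ^ lCount x n * qDig a (tDigit x n)

/-- `M_{k,a}(x)`: the `k`-th partial derivative of `F_a(x)` with respect to `a`. -/
noncomputable def Mfun (k : ℕ) (a x : ℝ) : ℝ :=
  iteratedDeriv k (fun b => Okamoto b x) a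

/-- `f` has derivative `+∞` at `x` (difference quotients over `y ∈ [0,1] \ {x}`). -/
def derivPInf (f : ℝ → ℝ) (x : ℝ) : Prop :=
  Tendsto (fun y => (f y - f x) / (y - x)) (𝓝[Set.Icc 0 1 \ {x}] x) atTop

/-- `f` has derivative `-∞` at `x`. -/
def derivMInf (f : ℝ → ℝ) (x : ℝ) : Prop :=
  Tendsto (fun y => (f y - f x) / (y - x)) (𝓝[Set.Icc 0 1 \ {x}] x) atBot

noncomputable def phiOk (a : ℝ) : ℝ :=
  if a = 1/3 then 1/3 else if a = 1/2 then 0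
  else Real.log (3 * a) / (Real.log a - Real.log |1 - 2 * a|)

noncomputable def C0 (a : ℝ) : ℝ := 1 / (Real.log a - Real.log |1 - 2 * a|)

noncomputable def hEnt (p : ℝ) : ℝ :=
  (-(p * Real.log p) - (1 - p) * Real.log (1 - p) + (1 - p) * Real.log 2) / Real.log 3

noncomputable def dOk (a : ℝ) : ℝ := hEnt (phiOk a)

noncomputable def dTilde (a : ℝ) : ℝ := hEnt (1 - 2 * a)

/-- `D^{+∞}_{k,a}`. -/
def DPlus (k : ℕ) (a : ℝ) : Set ℝ := {x ∈ Set.Ioo (0:ℝ) 1 | derivPInf (Mfun k a) x}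

/-- `D^{-∞}_{k,a}`. -/
def DMinus (k : ℕ) (a : ℝ) : Set ℝ := {x ∈ Set.Ioo (0:ℝ) 1 | derivMInf (Mfun k a) x}

/-! ### Ternary digits -/

theorem three_mul_floor_le (y : ℝ) : 3 * ⌊y⌋ ≤ ⌊3 * y⌋ ∧ ⌊3 * y⌋ ≤ 3 * ⌊y⌋ + 2 := by
  refine ⟨Int.le_floor.2 ?_, Int.le_of_lt_add_one (Int.floor_lt.2 ?_)⟩
  · push_cast
    linarith [Int.floor_le y]
  · push_cast
    linarith [Int.lt_floor_add_one y]

theorem floor_three_pow_succ {x : ℝ} (hx : x ≠ 1) (n : ℕ) :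
    ⌊(3:ℝ) ^ (n + 1) * x⌋ = 3 * ⌊(3:ℝ) ^ n * x⌋ + tDigit x n := by
  have h := three_mul_floor_le ((3:ℝ) ^ n * x)
  rw [← mul_assoc, ← pow_succ'] at h
  rw [tDigit, if_neg hx, Int.toNat_of_nonneg (by linarith)]
  ring

theorem tDigit_le_two (x : ℝ) (n : ℕ) : tDigit x n ≤ 2 := by
  by_cases hx : x = 1
  · simp [tDigit, hx]
  · have h := three_mul_floor_le ((3:ℝ) ^ n * x)
    rw [← mul_assoc, ← pow_succ'] at h
    have := floor_three_pow_succ hx n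
    lia

theorem ne_one_of_mem_Ico {z : ℝ} (hz : z ∈ Ico (0:ℝ) 1) : z ≠ 1 := hz.2.ne

theorem digit_add_div_three_mem_Ico {d : ℕ} (hd : d ≤ 2) {z : ℝ} (hz : z ∈ Ico (0:ℝ) 1) :
    (d + z) / 3 ∈ Ico (0:ℝ) 1 := by
  have : (d : ℝ) ≤ 2 := by exact_mod_cast hd
  have h0 : (0 : ℝ) ≤ d := by positivity
  exact ⟨by linarith [hz.1], by linarith [hz.2]⟩

theorem floor_pow_succ_mul_digit_add (d n : ℕ) (z : ℝ) :
    ⌊(3:ℝ) ^ (n + 1) * ((d + z) / 3)⌋ = 3 ^ n * d + ⌊(3:ℝ) ^ n * z⌋ := by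
  have : (3:ℝ) ^ (n + 1) * ((d + z) / 3) = ((3 ^ n * d : ℤ) : ℝ) + 3 ^ n * z := by
    push_cast
    ring
  rw [this, Int.floor_intCast_add]

theorem tDigit_digit_add_zero {d : ℕ} (hd : d ≤ 2) {z : ℝ} (hz : z ∈ Ico (0:ℝ) 1) :
    tDigit ((d + z) / 3) 0 = d := by
  have hx := digit_add_div_three_mem_Ico hd hz
  have h := floor_three_pow_succ (ne_one_of_mem_Ico hx) 0
  rw [floor_pow_succ_mul_digit_add, pow_zero, pow_zero, one_mul, one_mul, one_mul,
    Int.floor_eq_zero_iff.2 hz, Int.floor_eq_zero_iff.2 hx] at h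
  lia

theorem tDigit_digit_add_succ {d : ℕ} (hd : d ≤ 2) {z : ℝ} (hz : z ∈ Ico (0:ℝ) 1) (n : ℕ) :
    tDigit ((d + z) / 3) (n + 1) = tDigit z n := by
  have hx := digit_add_div_three_mem_Ico hd hz
  have h := floor_three_pow_succ (ne_one_of_mem_Ico hx) (n + 1)
  have h' := floor_three_pow_succ (ne_one_of_mem_Ico hz) n
  rw [floor_pow_succ_mul_digit_add, floor_pow_succ_mul_digit_add, h', pow_succ] at h
  lia

theorem lCount_le (x : ℝ) (n : ℕ) : lCount x n ≤ n :=
  (Finset.card_filter_le _ _).trans (by simp)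

theorem prod_ite_tDigit {K : Type*} [CommMonoid K] (A B : K) (x : ℝ) (n : ℕ) :
    ∏ i ∈ Finset.range n, (if tDigit x i = 1 then A else B) =
      B ^ (n - lCount x n) * A ^ lCount x n := by
  rw [Finset.prod_ite, Finset.prod_const, Finset.prod_const, mul_comm]
  congr 2
  have := Finset.card_filter_add_card_filter_not (s := Finset.range n) (fun i => tDigit x i = 1)
  rw [Finset.card_range] at this
  simp only [lCount]
  lia

/-- The remainder `σⁿ x` of `x` after removing `n` ternary digits. -/
noncomputable def tShift (x : ℝ) (n : ℕ) : ℝ := Int.fract ((3:ℝ) ^ n * x)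

theorem tShift_mem (x : ℝ) (n : ℕ) : tShift x n ∈ Ico (0:ℝ) 1 :=
  ⟨Int.fract_nonneg _, Int.fract_lt_one _⟩

theorem tShift_zero {x : ℝ} (hx : x ∈ Ico (0:ℝ) 1) : tShift x 0 = x := by
  rw [tShift, pow_zero, one_mul, Int.fract_eq_self.2 hx]

theorem tShift_eq {x : ℝ} (hx : x ∈ Ico (0:ℝ) 1) (n : ℕ) :
    tShift x n = (tDigit x n + tShift x (n + 1)) / 3 := by
  have h := floor_three_pow_succ (ne_one_of_mem_Ico hx) n
  have h' : ((⌊(3:ℝ) ^ (n + 1) * x⌋ : ℤ) : ℝ) = 3 * ⌊(3:ℝ) ^ n * x⌋ + tDigit x n := by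
    rw [h]
    push_cast
    ring
  simp only [tShift, Int.fract]
  rw [h']
  ring

theorem tDigit_tShift {x : ℝ} (hx : x ∈ Ico (0:ℝ) 1) (n i : ℕ) :
    tDigit (tShift x n) i = tDigit x (n + i) := by
  induction n generalizing i with
  | zero => rw [tShift_zero hx, zero_add]
  | succ n ih =>
    rw [← tDigit_digit_add_succ (tDigit_le_two x n) (tShift_mem x (n + 1)), ← tShift_eq hx, ih]
    congr 1
    ring

theorem eq_floor_add_tShift (x : ℝ) (n : ℕ) :
    x = (⌊(3:ℝ) ^ n * x⌋ + tShift x n) / 3 ^ n := by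
  rw [tShift, Int.floor_add_fract, mul_div_cancel_left₀]
  positivity

/-! ### Functional equation of Okamoto's function -/

/-- The contraction ratio in the value direction belonging to a ternary digit. -/
noncomputable def rDig (a : ℝ) (d : ℕ) : ℝ := if d = 1 then 1 - 2 * a else a

/-- The increment of `F_a` over the triadic interval of order `n` containing `x`. -/
noncomputable def tWeight (a x : ℝ) (n : ℕ) : ℝ := ∏ i ∈ Finset.range n, rDig a (tDigit x i)

theorem tWeight_eq (a x : ℝ) (n : ℕ) :
    tWeight a x n = a ^ (n - lCount x n) * (1 - 2 * a) ^ lCount x n :=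
  prod_ite_tDigit _ _ _ _

theorem Okamoto_eq (a x : ℝ) :
    Okamoto a x = ∑' n, tWeight a x n * qDig a (tDigit x n) := by
  simp only [tWeight_eq]
  rfl

theorem tWeight_succ (a x : ℝ) (n : ℕ) :
    tWeight a x (n + 1) = tWeight a x n * rDig a (tDigit x n) :=
  Finset.prod_range_succ _ _

theorem abs_rDig_le (a : ℝ) (d : ℕ) : |rDig a d| ≤ max |a| |1 - 2 * a| := by
  unfold rDig
  split_ifs
  · exact le_max_right _ _
  · exact le_max_left _ _

theorem abs_qDig_le {a : ℝ} (ha : 0 < a) (ha' : a < 1) (d : ℕ) : |qDig a d| ≤ 1 := by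
  unfold qDig
  split_ifs <;> rw [abs_le] <;> constructor <;> linarith

theorem abs_tWeight_le (a x : ℝ) (n : ℕ) : |tWeight a x n| ≤ max |a| |1 - 2 * a| ^ n := by
  rw [tWeight, Finset.abs_prod]
  refine (Finset.prod_le_prod (fun _ _ => abs_nonneg _) (fun i _ => abs_rDig_le a _)).trans ?_
  simp

theorem summable_Okamoto {a : ℝ} (ha : 0 < a) (ha' : a < 1) (x : ℝ) :
    Summable fun n => tWeight a x n * qDig a (tDigit x n) := by
  have h1 : max |a| |1 - 2 * a| < 1 :=
    max_lt (abs_lt.2 ⟨by linarith, ha'⟩) (abs_lt.2 ⟨by linarith, by linarith⟩)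
  refine Summable.of_norm_bounded
    (summable_geometric_of_lt_one (le_max_of_le_left (abs_nonneg a)) h1) fun n => ?_
  rw [Real.norm_eq_abs, abs_mul]
  calc _ ≤ max |a| |1 - 2 * a| ^ n * 1 :=
        mul_le_mul (abs_tWeight_le a x n) (abs_qDig_le ha ha' _) (abs_nonneg _) (by positivity)
    _ = _ := mul_one _

theorem tWeight_digit_add_succ (a : ℝ) {d : ℕ} (hd : d ≤ 2) {z : ℝ} (hz : z ∈ Ico (0:ℝ) 1)
    (n : ℕ) : tWeight a ((d + z) / 3) (n + 1) = rDig a d * tWeight a z n := by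
  rw [tWeight, Finset.prod_range_succ', tDigit_digit_add_zero hd hz, mul_comm]
  simp only [tDigit_digit_add_succ hd hz]
  rfl

theorem Okamoto_digit_add_of_lt {a : ℝ} (ha : 0 < a) (ha' : a < 1) {d : ℕ} (hd : d ≤ 2) {z : ℝ}
    (hz : z ∈ Ico (0:ℝ) 1) :
    Okamoto a ((d + z) / 3) = qDig a d + rDig a d * Okamoto a z := by
  rw [Okamoto_eq, Okamoto_eq, (summable_Okamoto ha ha' _).tsum_eq_zero_add,
    tDigit_digit_add_zero hd hz, ← tsum_mul_left]
  simp only [tDigit_digit_add_succ hd hz, tWeight_digit_add_succ a hd hz, mul_assoc]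
  simp [tWeight]

theorem Okamoto_zero {a : ℝ} : Okamoto a 0 = 0 := by
  have h : ∀ n, tDigit 0 n = 0 := fun n => by simp [tDigit]
  simp [Okamoto_eq, h, qDig]

theorem Okamoto_one {a : ℝ} (ha : 0 < a) (ha' : a < 1) : Okamoto a 1 = 1 := by
  have h : ∀ n, tDigit 1 n = 2 := fun n => by simp [tDigit]
  have : (1 - a) ≠ 0 := by linarith
  simp [Okamoto_eq, h, qDig, tWeight, rDig, tsum_mul_right, tsum_geometric_of_lt_one ha.le ha',
    this]

theorem Okamoto_digit_add {a : ℝ} (ha : 0 < a) (ha' : a < 1) {d : ℕ} (hd : d ≤ 2) {z : ℝ}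
    (hz : z ∈ Icc (0:ℝ) 1) :
    Okamoto a ((d + z) / 3) = qDig a d + rDig a d * Okamoto a z := by
  rcases hz.2.lt_or_eq with h | rfl
  · exact Okamoto_digit_add_of_lt ha ha' hd ⟨hz.1, h⟩
  rw [Okamoto_one ha ha', mul_one]
  have h0 : (0:ℝ) ∈ Ico (0:ℝ) 1 := by simp
  obtain rfl | rfl | rfl : d = 0 ∨ d = 1 ∨ d = 2 := by lia
  · have := Okamoto_digit_add_of_lt ha ha' (d := 1) (by norm_num) h0
    rw [Okamoto_zero] at this
    norm_num [qDig, rDig] at this ⊢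
    exact this
  · have := Okamoto_digit_add_of_lt ha ha' (d := 2) (by norm_num) h0
    rw [Okamoto_zero] at this
    norm_num [qDig, rDig] at this ⊢
    rw [this]
    ring
  · norm_num [qDig, rDig]
    rw [Okamoto_one ha ha']

theorem digit_add_div_three_mem_Icc {d : ℕ} (hd : d ≤ 2) {z : ℝ} (hz : z ∈ Icc (0:ℝ) 1) :
    (d + z) / 3 ∈ Icc (0:ℝ) 1 := by
  have : (d : ℝ) ≤ 2 := by exact_mod_cast hd
  have h0 : (0 : ℝ) ≤ d := by positivity
  exact ⟨by linarith [hz.1], by linarith [hz.2]⟩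

/-- `F_a` is affine-equivalent to itself on the triadic interval of order `n` containing `x`. -/
theorem Okamoto_triadic_sub {a : ℝ} (ha : 0 < a) (ha' : a < 1) {x : ℝ} (hx : x ∈ Ico (0:ℝ) 1)
    (n : ℕ) {z z' : ℝ} (hz : z ∈ Icc (0:ℝ) 1) (hz' : z' ∈ Icc (0:ℝ) 1) :
    Okamoto a ((⌊(3:ℝ) ^ n * x⌋ + z) / 3 ^ n) - Okamoto a ((⌊(3:ℝ) ^ n * x⌋ + z') / 3 ^ n) =
      tWeight a x n * (Okamoto a z - Okamoto a z') := by
  induction n generalizing z z' with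
  | zero =>
    have : ⌊x⌋ = 0 := Int.floor_eq_zero_iff.2 hx
    simp [this, tWeight]
  | succ n ih =>
    have key : ∀ w : ℝ, ((⌊(3:ℝ) ^ (n + 1) * x⌋ : ℝ) + w) / 3 ^ (n + 1) =
        (⌊(3:ℝ) ^ n * x⌋ + ((tDigit x n + w) / 3)) / 3 ^ n := fun w => by
      rw [floor_three_pow_succ (ne_one_of_mem_Ico hx)]
      push_cast
      field_simp
      ring
    have hd := tDigit_le_two x n
    rw [key, key, ih (digit_add_div_three_mem_Icc hd hz) (digit_add_div_three_mem_Icc hd hz'),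
      Okamoto_digit_add ha ha' hd hz, Okamoto_digit_add ha ha' hd hz', tWeight_succ]
    ring

theorem rDig_pos {a : ℝ} (ha : 0 < a) (ha' : a < 1 / 2) (d : ℕ) : 0 < rDig a d := by
  unfold rDig
  split_ifs <;> linarith

theorem qDig_nonneg {a : ℝ} (ha : 0 < a) (ha' : a < 1) (d : ℕ) : 0 ≤ qDig a d := by
  unfold qDig
  split_ifs <;> linarith

theorem qDig_add_rDig_le {a : ℝ} (ha : 0 < a) (ha' : a < 1 / 2) (d : ℕ) :
    qDig a d + rDig a d ≤ 1 := by
  unfold qDig rDig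
  split_ifs <;> linarith

theorem qDig_add_rDig_le_qDig {a : ℝ} (ha' : a < 1 / 2) {d e : ℕ} (he : e ≤ 2)
    (h : d < e) : qDig a d + rDig a d ≤ qDig a e := by
  obtain ⟨rfl, rfl⟩ | ⟨rfl, rfl⟩ | ⟨rfl, rfl⟩ :
    (d = 0 ∧ e = 1) ∨ (d = 0 ∧ e = 2) ∨ (d = 1 ∧ e = 2) := by lia
  all_goals norm_num [qDig, rDig]
  all_goals linarith

theorem tWeight_pos {a : ℝ} (ha : 0 < a) (ha' : a < 1 / 2) (x : ℝ) (n : ℕ) :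
    0 < tWeight a x n :=
  Finset.prod_pos fun _ _ => rDig_pos ha ha' _

theorem Okamoto_nonneg {a : ℝ} (ha : 0 < a) (ha' : a < 1 / 2) (x : ℝ) : 0 ≤ Okamoto a x := by
  rw [Okamoto_eq]
  exact tsum_nonneg fun n =>
    mul_nonneg (tWeight_pos ha ha' x n).le (qDig_nonneg ha (by linarith) _)

theorem Okamoto_le_one {a : ℝ} (ha : 0 < a) (ha' : a < 1 / 2) (x : ℝ) : Okamoto a x ≤ 1 := by
  have key : ∀ n, ∑ i ∈ Finset.range n, tWeight a x i * qDig a (tDigit x i) + tWeight a x n ≤ 1 := by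
    intro n
    induction n with
    | zero => simp [tWeight]
    | succ n ih =>
      have h2 := mul_le_mul_of_nonneg_left (qDig_add_rDig_le ha ha' (tDigit x n))
        (tWeight_pos ha ha' x n).le
      rw [Finset.sum_range_succ, tWeight_succ]
      linarith
  rw [Okamoto_eq]
  refine (summable_Okamoto ha (by linarith) x).tsum_le_of_sum_range_le fun n => ?_
  linarith [key n, tWeight_pos ha ha' x n]

theorem Okamoto_third {x : ℝ} (hx : x ∈ Ico (0:ℝ) 1) : Okamoto (1 / 3) x = x := by
  have key : ∀ n, |Okamoto (1 / 3) x - x| = (1 / 3) ^ n *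
      |Okamoto (1 / 3) (tShift x n) - tShift x n| := by
    intro n
    induction n with
    | zero => rw [tShift_zero hx, pow_zero, one_mul]
    | succ n ih =>
      have hm := tShift_mem x (n + 1)
      rw [ih, tShift_eq hx n, Okamoto_digit_add_of_lt (by norm_num) (by norm_num)
        (tDigit_le_two x n) hm]
      have hq : qDig (1 / 3) (tDigit x n) = (tDigit x n : ℝ) / 3 := by
        have := tDigit_le_two x n
        interval_cases tDigit x n <;> norm_num [qDig]
      have hr : rDig (1 / 3) (tDigit x n) = 1 / 3 := by
        unfold rDig
        split_ifs <;> norm_num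
      rw [hq, hr, show ∀ d F z : ℝ, d / 3 + 1 / 3 * F - (d + z) / 3 = 1 / 3 * (F - z) from
        fun d F z => by ring, abs_mul, abs_of_pos (by norm_num : (0:ℝ) < 1 / 3)]
      ring
  have hlim : Tendsto (fun n : ℕ => (1 / 3 : ℝ) ^ n * 1) atTop (𝓝 (0 * 1)) :=
    (tendsto_pow_atTop_nhds_zero_of_lt_one (by norm_num) (by norm_num)).mul_const 1
  have h0 : |Okamoto (1 / 3) x - x| ≤ 0 * 1 := by
    refine ge_of_tendsto' hlim fun n => ?_
    rw [key n]
    gcongr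
    have hm := tShift_mem x n
    have h1 := Okamoto_nonneg (a := 1 / 3) (by norm_num) (by norm_num) (tShift x n)
    have h2 := Okamoto_le_one (a := 1 / 3) (by norm_num) (by norm_num) (tShift x n)
    rw [abs_le]
    constructor <;> linarith [hm.1, hm.2]
  rw [zero_mul] at h0
  linarith [abs_nonpos_iff.1 h0]

/-! ### Separation of points with different leading digits -/

theorem Okamoto_mem_of_digit_one {a ρ : ℝ} (ha : 0 < a) (ha' : a < 1 / 2) (hρ : 0 < ρ)
    (hρa : ρ ≤ a) (hρb : ρ ≤ 1 - 2 * a) {i : ℕ} {x : ℝ} (hx : x ∈ Ico (0:ℝ) 1)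
    (h : tDigit x i = 1) :
    ρ ^ (i + 1) ≤ Okamoto a x ∧ Okamoto a x ≤ 1 - ρ ^ (i + 1) := by
  induction i generalizing x with
  | zero =>
    rw [← tShift_zero hx, tShift_eq hx, Okamoto_digit_add_of_lt ha (by linarith)
      (tDigit_le_two x 0) (tShift_mem x _), h]
    have h1 := Okamoto_nonneg ha ha' (tShift x (0 + 1))
    have h2 := Okamoto_le_one ha ha' (tShift x (0 + 1))
    norm_num [qDig, rDig] at *
    constructor <;> nlinarith
  | succ i ih =>
    have hd := tDigit_tShift hx 1 i
    rw [add_comm 1 i, h] at hd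
    obtain ⟨h1, h2⟩ := ih (tShift_mem x 1) hd
    rw [← tShift_zero hx, tShift_eq hx, Okamoto_digit_add_of_lt ha (by linarith)
      (tDigit_le_two x 0) (tShift_mem x _)]
    set r := rDig a (tDigit x 0) with hr
    have hrρ : ρ ≤ r := by
      rw [hr]
      unfold rDig
      split_ifs <;> assumption
    have h3 := qDig_nonneg ha (by linarith) (tDigit x 0)
    have h4 := qDig_add_rDig_le ha ha' (tDigit x 0)
    have hp : (0:ℝ) < ρ ^ (i + 1) := by positivity
    rw [zero_add, pow_succ ρ (i + 1), mul_comm (ρ ^ (i + 1))]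
    have h5 := mul_le_mul hrρ h1 hp.le (by linarith)
    have h6 := mul_le_mul hrρ (by linarith : ρ ^ (i + 1) ≤ 1 - Okamoto a (tShift x 1)) hp.le
      (by linarith)
    constructor <;> nlinarith

/-- Two points with different leading digits, the second digits of `x` containing an early `1`,
have well separated values. -/
theorem Okamoto_gap {a ρ : ℝ} (ha : 0 < a) (ha' : a < 1 / 2) (hρ : 0 < ρ)
    (hρa : ρ ≤ a) (hρb : ρ ≤ 1 - 2 * a) {i : ℕ} {x y : ℝ} (hx : x ∈ Ico (0:ℝ) 1)
    (hy : y ∈ Ico (0:ℝ) 1) (h : tDigit x (i + 1) = 1) :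
    (tDigit x 0 < tDigit y 0 → ρ ^ (i + 2) ≤ Okamoto a y - Okamoto a x) ∧
    (tDigit y 0 < tDigit x 0 → ρ ^ (i + 2) ≤ Okamoto a x - Okamoto a y) := by
  have hd := tDigit_tShift hx 1 i
  rw [add_comm 1 i, h] at hd
  obtain ⟨h1, h2⟩ := Okamoto_mem_of_digit_one ha ha' hρ hρa hρb (tShift_mem x 1) hd
  have ex : Okamoto a x = qDig a (tDigit x 0) + rDig a (tDigit x 0) * Okamoto a (tShift x 1) := by
    conv_lhs => rw [← tShift_zero hx, tShift_eq hx, Okamoto_digit_add_of_lt ha (by linarith)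
      (tDigit_le_two x 0) (tShift_mem x _)]
  have ey : Okamoto a y = qDig a (tDigit y 0) + rDig a (tDigit y 0) * Okamoto a (tShift y 1) := by
    conv_lhs => rw [← tShift_zero hy, tShift_eq hy, Okamoto_digit_add_of_lt ha (by linarith)
      (tDigit_le_two y 0) (tShift_mem y _)]
  have hrx : ρ ≤ rDig a (tDigit x 0) := by
    unfold rDig
    split_ifs <;> assumption
  have hry := rDig_pos ha ha' (tDigit y 0)
  have hp : (0:ℝ) < ρ ^ (i + 1) := by positivity
  rw [ex, ey, pow_succ ρ (i + 1), mul_comm (ρ ^ (i + 1))]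
  have h5 := mul_le_mul hrx h1 hp.le (by linarith)
  have h6 := mul_le_mul hrx (by linarith : ρ ^ (i + 1) ≤ 1 - Okamoto a (tShift x 1)) hp.le
    (by linarith)
  have h7 := mul_nonneg hry.le (Okamoto_nonneg ha ha' (tShift y 1))
  have h8 := mul_nonneg hry.le (sub_nonneg.2 (Okamoto_le_one ha ha' (tShift y 1)))
  refine ⟨fun hlt => ?_, fun hlt => ?_⟩
  · have := qDig_add_rDig_le_qDig ha' (tDigit_le_two y 0) hlt
    nlinarith
  · have := qDig_add_rDig_le_qDig ha' (tDigit_le_two x 0) hlt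
    nlinarith

/-! ### Smooth dependence on the parameter -/

/-- Okamoto's function with complex parameter. -/
noncomputable def okamotoC (z : ℂ) (x : ℝ) : ℂ :=
  ∑' n, (∏ i ∈ Finset.range n, if tDigit x i = 1 then 1 - 2 * z else z) *
    (if tDigit x n = 0 then 0 else if tDigit x n = 1 then z else 1 - z)

theorem okamotoC_ofReal (a x : ℝ) : okamotoC a x = Okamoto a x := by
  rw [Okamoto_eq, okamotoC, Complex.ofReal_tsum]
  congr with n
  unfold tWeight rDig qDig
  push_cast
  congr 1
  · refine Finset.prod_congr rfl fun i _ => ?_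
    split_ifs <;> simp
  · split_ifs <;> simp

theorem okamotoC_bound {a : ℝ} (ha : 0 < a) (ha' : a < 1 / 2) {z : ℂ}
    (hz : z ∈ Metric.ball (a : ℂ) (a / 2)) (x : ℝ) (n : ℕ) :
    ‖(∏ i ∈ Finset.range n, if tDigit x i = 1 then 1 - 2 * z else z) *
      (if tDigit x n = 0 then 0 else if tDigit x n = 1 then z else 1 - z)‖ ≤
        max (3 / 4) (1 - a) ^ n * 2 := by
  rw [Metric.mem_ball, dist_eq_norm] at hz
  have hna : ‖(a : ℂ)‖ = a := by simp [abs_of_pos ha]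
  have h1 : ‖z‖ ≤ 3 / 4 := by
    have := norm_add_le (z - a) (a : ℂ)
    rw [sub_add_cancel, hna] at this
    linarith
  have h2 : ‖1 - 2 * z‖ ≤ 1 - a := by
    have := norm_sub_le ((1 - 2 * a : ℝ) : ℂ) (2 * (z - a))
    rw [Complex.norm_real, Real.norm_eq_abs, abs_of_pos (by linarith), norm_mul,
      Complex.norm_ofNat] at this
    rw [show (1 - 2 * z) = ((1 - 2 * a : ℝ) : ℂ) - 2 * (z - a) by push_cast; ring]
    linarith
  rw [norm_mul, norm_prod]
  gcongr
  · have : ∀ i ∈ Finset.range n, ‖if tDigit x i = 1 then 1 - 2 * z else z‖ ≤ max (3 / 4) (1 - a) := by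
      intro i _
      split_ifs
      · exact h2.trans (le_max_right _ _)
      · exact h1.trans (le_max_left _ _)
    simpa using Finset.prod_le_prod (fun _ _ => norm_nonneg _) this
  · have := norm_sub_le 1 z
    rw [norm_one] at this
    split_ifs
    · simp
    · linarith
    · linarith

theorem summable_okamotoC_bound {a : ℝ} (ha : 0 < a) :
    Summable fun n : ℕ => max (3 / 4) (1 - a) ^ n * 2 :=
  (summable_geometric_of_lt_one (le_max_of_le_left (by norm_num))
    (max_lt (by norm_num) (by linarith))).mul_right 2

theorem differentiableOn_okamotoC {a : ℝ} (ha : 0 < a) (ha' : a < 1 / 2) (x : ℝ) :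
    DifferentiableOn ℂ (fun z => okamotoC z x) (Metric.ball (a : ℂ) (a / 2)) := by
  refine Complex.differentiableOn_tsum_of_summable_norm (summable_okamotoC_bound ha) (fun n => ?_)
    Metric.isOpen_ball fun n z hz => okamotoC_bound ha ha' hz x n
  refine DifferentiableOn.mul (DifferentiableOn.fun_finsetProd fun i _ => ?_) ?_
  · split_ifs <;> fun_prop
  · split_ifs <;> fun_prop

theorem norm_okamotoC_le {a : ℝ} (ha : 0 < a) (ha' : a < 1 / 2) {z : ℂ}
    (hz : z ∈ Metric.ball (a : ℂ) (a / 2)) (x : ℝ) :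
    ‖okamotoC z x‖ ≤ ∑' n : ℕ, max (3 / 4) (1 - a) ^ n * 2 :=
  tsum_of_norm_bounded (summable_okamotoC_bound ha).hasSum (okamotoC_bound ha ha' hz x)

theorem iteratedDeriv_re_of_analyticOnNhd {G : ℂ → ℂ} {U : Set ℂ} (hU : IsOpen U)
    (hG : AnalyticOnNhd ℂ G U) (j : ℕ) {b : ℝ} (hb : (b : ℂ) ∈ U) :
    iteratedDeriv j (fun t : ℝ => (G t).re) b = (iteratedDeriv j G b).re := by
  induction j generalizing b with
  | zero => simp
  | succ j ih =>
    have hev : iteratedDeriv j (fun t : ℝ => (G t).re) =ᶠ[𝓝 b]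
        fun t => (iteratedDeriv j G t).re := by
      filter_upwards [Complex.continuous_ofReal.continuousAt.preimage_mem_nhds (hU.mem_nhds hb)]
        with t ht using ih ht
    have hA : AnalyticAt ℂ (iteratedDeriv j G) b := by
      rw [iteratedDeriv_eq_iterate]
      exact (hG b hb).iterated_deriv j
    rw [iteratedDeriv_succ, hev.deriv_eq, iteratedDeriv_succ]
    exact hA.differentiableAt.hasDerivAt.real_of_complex.deriv

theorem Okamoto_eq_re (x : ℝ) : (fun b => Okamoto b x) = fun b : ℝ => (okamotoC b x).re := by
  funext b
  rw [okamotoC_ofReal, Complex.ofReal_re]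

theorem contDiffAt_Okamoto {a : ℝ} (ha : 0 < a) (ha' : a < 1 / 2) (x : ℝ) (n : ℕ) :
    ContDiffAt ℝ n (fun b => Okamoto b x) a := by
  rw [Okamoto_eq_re]
  have h : AnalyticAt ℂ (fun z => okamotoC z x) a :=
    (differentiableOn_okamotoC ha ha' x).analyticAt (Metric.ball_mem_nhds _ (by positivity))
  exact h.contDiffAt.real_of_complex

theorem exists_iteratedDeriv_Okamoto_bound {a : ℝ} (ha : 0 < a) (ha' : a < 1 / 2) (j : ℕ) :
    ∃ C, ∀ x, |iteratedDeriv j (fun b => Okamoto b x) a| ≤ C := by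
  refine ⟨j.factorial * (∑' n : ℕ, max (3 / 4) (1 - a) ^ n * 2) / (a / 4) ^ j, fun x => ?_⟩
  have hd := differentiableOn_okamotoC ha ha' x
  have hsub : Metric.closedBall (a : ℂ) (a / 4) ⊆ Metric.ball (a : ℂ) (a / 2) :=
    Metric.closedBall_subset_ball (by linarith)
  rw [Okamoto_eq_re, iteratedDeriv_re_of_analyticOnNhd Metric.isOpen_ball
    (hd.analyticOnNhd Metric.isOpen_ball) j (Metric.mem_ball_self (by positivity))]
  refine (Complex.abs_re_le_norm _).trans ?_
  refine Complex.norm_iteratedDeriv_le_of_forall_mem_sphere_norm_le j (by positivity) ?_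
    fun z hz => norm_okamotoC_le ha ha' (hsub (Metric.sphere_subset_closedBall hz)) x
  refine (hd.mono ?_).diffContOnCl
  exact (closure_mono Metric.ball_subset_closedBall).trans
    (Metric.isClosed_closedBall.closure_eq.le.trans hsub)

/-! ### Leading order of high parameter derivatives -/

theorem iteratedDeriv_affine_pow (c d : ℝ) (p i : ℕ) :
    iteratedDeriv i (fun b : ℝ => (c + d * b) ^ p) =
      fun b => p.descFactorial i * d ^ i * (c + d * b) ^ (p - i) := by
  induction i with
  | zero => simp
  | succ i ih =>
    rw [iteratedDeriv_succ, ih]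
    funext b
    have h : HasDerivAt (fun b : ℝ => c + d * b) d b := by
      simpa using! ((hasDerivAt_id b).const_mul d).const_add c
    rw [((h.fun_pow (p - i)).const_mul _).deriv, Nat.descFactorial_succ]
    push_cast
    rw [Nat.sub_sub]
    ring

theorem abs_descFactorial_sub_pow_le (p i : ℕ) {n : ℝ} (hn : 1 ≤ n) (hp : (p : ℝ) ≤ n) :
    |(p.descFactorial i : ℝ) - (p : ℝ) ^ i| ≤ i ^ 2 * (n ^ i / n) := by
  induction i with
  | zero => simp
  | succ i ih =>
    have hrec : (p.descFactorial (i + 1) : ℝ) = ((p : ℝ) - i) * p.descFactorial i := by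
      rw [Nat.descFactorial_succ]
      rcases le_or_gt i p with h | h
      · push_cast [Nat.cast_sub h]
        rfl
      · simp [Nat.descFactorial_eq_zero_iff_lt.2 h]
    have hD : (p.descFactorial i : ℝ) ≤ n ^ i := by
      calc (p.descFactorial i : ℝ) ≤ (p : ℝ) ^ i := by exact_mod_cast Nat.descFactorial_le_pow p i
        _ ≤ n ^ i := by gcongr
    have h0 : (0:ℝ) ≤ p.descFactorial i := by positivity
    have hp0 : (0:ℝ) ≤ p := by positivity
    rw [hrec, show ((p : ℝ) - i) * p.descFactorial i - (p : ℝ) ^ (i + 1) =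
      p * (p.descFactorial i - (p : ℝ) ^ i) - i * p.descFactorial i by ring]
    calc _ ≤ |(p : ℝ) * (p.descFactorial i - (p : ℝ) ^ i)| + |i * (p.descFactorial i : ℝ)| :=
          abs_sub _ _
      _ = p * |(p.descFactorial i - (p : ℝ) ^ i)| + i * p.descFactorial i := by
          rw [abs_mul, Nat.abs_cast, abs_of_nonneg (by positivity : 0 ≤ (i : ℝ) * _)]
      _ ≤ n * (i ^ 2 * (n ^ i / n)) + i * n ^ i := by gcongr
      _ = (i ^ 2 + i) * n ^ i := by field_simp
      _ ≤ (i + 1) ^ 2 * n ^ i := by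
          gcongr
          nlinarith [(Nat.cast_nonneg i : (0:ℝ) ≤ i)]
      _ = _ := by
          push_cast
          rw [pow_succ n, mul_div_cancel_right₀ _ (by linarith)]

theorem abs_iteratedDeriv_affine_pow_sub_le {c d a s : ℝ} (hs : c + d * a = s) (hs0 : s ≠ 0)
    (p i : ℕ) {n : ℝ} (hn : 1 ≤ n) (hp : (p : ℝ) ≤ n) :
    |iteratedDeriv i (fun b : ℝ => (c + d * b) ^ p) a - s ^ p * (d / s * p) ^ i| ≤
      |s ^ p| * (|d / s| ^ i * i ^ 2) * (n ^ i / n) := by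
  have key : (p.descFactorial i : ℝ) * d ^ i * s ^ (p - i) =
      s ^ p * (d / s) ^ i * p.descFactorial i := by
    rcases le_or_gt i p with h | h
    · rw [pow_sub₀ _ hs0 h, div_pow]
      ring
    · simp [Nat.descFactorial_eq_zero_iff_lt.2 h]
  rw [iteratedDeriv_affine_pow]
  simp only [hs]
  rw [key, mul_pow, ← mul_assoc, ← mul_sub, abs_mul, abs_mul, abs_pow (d / s)]
  calc _ ≤ |s ^ p| * |d / s| ^ i * (i ^ 2 * (n ^ i / n)) := by
        gcongr
        exact abs_descFactorial_sub_pow_le p i hn hp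
    _ = _ := by ring

theorem abs_mul_sub_mul_le {K n A B v w α β F G : ℝ} {i j : ℕ} (hK : 1 ≤ K) (hn : 1 ≤ n)
    (hv : |v| ≤ K * n) (hw : |w| ≤ K * n) (hα : |α| ≤ K) (hβ : |β| ≤ K)
    (hF : |F - A * v ^ i * α| ≤ |A| * K * (n ^ i / n))
    (hG : |G - B * w ^ j * β| ≤ |B| * K * (n ^ j / n)) :
    |F * G - A * B * (v ^ i * w ^ j) * (α * β)| ≤
      |A * B| * (3 * K ^ (i + j + 2)) * (n ^ (i + j) / n) := by
  have hK0 : 0 < K := by linarith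
  have hn0 : 0 < n := by linarith
  have hvi : |A * v ^ i * α| ≤ |A| * (K ^ (i + 1) * n ^ i) := by
    rw [abs_mul, abs_mul, abs_pow, mul_assoc]
    refine mul_le_mul_of_nonneg_left ?_ (abs_nonneg _)
    calc |v| ^ i * |α| ≤ (K * n) ^ i * K := by gcongr
      _ = _ := by ring
  have hwj : |B * w ^ j * β| ≤ |B| * (K ^ (j + 1) * n ^ j) := by
    rw [abs_mul, abs_mul, abs_pow, mul_assoc]
    refine mul_le_mul_of_nonneg_left ?_ (abs_nonneg _)
    calc |w| ^ j * |β| ≤ (K * n) ^ j * K := by gcongr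
      _ = _ := by ring
  have hG' : |G| ≤ |B| * (2 * K ^ (j + 1) * n ^ j) := by
    have h1 : n ^ j / n ≤ n ^ j := div_le_self (by positivity) hn
    have h2 : K ≤ K ^ (j + 1) := le_self_pow₀ hK (by lia)
    have h3 : |B| * K * (n ^ j / n) ≤ |B| * K ^ (j + 1) * n ^ j := by gcongr
    have := abs_add_le (G - B * w ^ j * β) (B * w ^ j * β)
    rw [sub_add_cancel] at this
    linarith
  have e : F * G - A * B * (v ^ i * w ^ j) * (α * β) =
      (F - A * v ^ i * α) * G + (A * v ^ i * α) * (G - B * w ^ j * β) := by ring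
  rw [e]
  refine (abs_add_le _ _).trans ?_
  rw [abs_mul, abs_mul _ (G - _)]
  have hp1 : K ^ (j + 2) ≤ K ^ (i + j + 2) := pow_le_pow_right₀ hK (by lia)
  have hp2 : K ^ (i + 2) ≤ K ^ (i + j + 2) := pow_le_pow_right₀ hK (by lia)
  calc _ ≤ |A| * K * (n ^ i / n) * (|B| * (2 * K ^ (j + 1) * n ^ j)) +
        |A| * (K ^ (i + 1) * n ^ i) * (|B| * K * (n ^ j / n)) := by gcongr
    _ = |A * B| * (2 * K ^ (j + 2) + K ^ (i + 2)) * (n ^ (i + j) / n) := by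
        rw [abs_mul]
        ring
    _ ≤ _ := by
        gcongr
        linarith

/-- The Leibniz rule for functions whose derivatives at `a` are, to leading order in the large
parameter `n`, those of exponentials. -/
theorem abs_iteratedDeriv_mul_sub_le {K : ℝ} (hK : 1 ≤ K) {k : ℕ} {f g : ℝ → ℝ} {a : ℝ}
    {n A B v w α β : ℝ} (hf : ContDiffAt ℝ k f a) (hg : ContDiffAt ℝ k g a) (hn : 1 ≤ n)
    (hv : |v| ≤ K * n) (hw : |w| ≤ K * n) (hα : |α| ≤ K) (hβ : |β| ≤ K)
    (hF : ∀ i ≤ k, |iteratedDeriv i f a - A * v ^ i * α| ≤ |A| * K * (n ^ i / n))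
    (hG : ∀ i ≤ k, |iteratedDeriv i g a - B * w ^ i * β| ≤ |B| * K * (n ^ i / n)) :
    ∀ i ≤ k, |iteratedDeriv i (f * g) a - A * B * (v + w) ^ i * (α * β)| ≤
      |A * B| * (2 ^ k * (3 * K ^ (k + 2))) * (n ^ i / n) := by
  intro i hi
  have hi' : ((i : ℕ) : WithTop ℕ∞) ≤ k := by exact_mod_cast hi
  have hn0 : 0 < n := by linarith
  have hK0 : 0 < K := by linarith
  rw [iteratedDeriv_mul (hf.of_le hi') (hg.of_le hi'), add_pow, Finset.mul_sum, Finset.sum_mul,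
    ← Finset.sum_sub_distrib]
  calc _ ≤ ∑ m ∈ Finset.range (i + 1), (i.choose m : ℝ) *
        (|A * B| * (3 * K ^ (k + 2)) * (n ^ i / n)) := by
        refine (Finset.abs_sum_le_sum_abs _ _).trans (Finset.sum_le_sum fun m hm => ?_)
        have hm : m ≤ i := Nat.lt_succ_iff.1 (Finset.mem_range.1 hm)
        rw [show ∀ c F G X : ℝ, c * F * G - A * B * (X * c) * (α * β) =
          c * (F * G - A * B * X * (α * β)) from fun c F G X => by ring, abs_mul,
          abs_of_nonneg (by positivity : (0:ℝ) ≤ (i.choose m : ℝ))]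
        have h := abs_mul_sub_mul_le hK hn hv hw hα hβ (hF m (hm.trans hi))
          (hG (i - m) ((Nat.sub_le _ _).trans hi))
        rw [Nat.add_sub_cancel' hm] at h
        have : K ^ (i + 2) ≤ K ^ (k + 2) := pow_le_pow_right₀ hK (by lia)
        refine mul_le_mul_of_nonneg_left (h.trans ?_) (by positivity)
        gcongr
    _ = 2 ^ i * (|A * B| * (3 * K ^ (k + 2)) * (n ^ i / n)) := by
        rw [← Finset.sum_mul]
        congr 1
        exact_mod_cast Nat.sum_range_choose i
    _ ≤ 2 ^ k * (|A * B| * (3 * K ^ (k + 2)) * (n ^ i / n)) := by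
        gcongr
        norm_num
    _ = _ := by ring

/-- The logarithmic derivative of `a ↦ a ^ p * (1 - 2 * a) ^ l`. -/
noncomputable def logSlope (a : ℝ) (p l : ℕ) : ℝ := p / a - 2 * l / (1 - 2 * a)

theorem exists_iteratedDeriv_weight_mul_bound {a : ℝ} (ha : 0 < a) (ha' : a < 1 / 2) (k : ℕ) :
    ∃ C, 1 ≤ C ∧ ∀ (p l n : ℕ), 1 ≤ n → p ≤ n → l ≤ n → ∀ x y : ℝ,
      |iteratedDeriv k (fun b => b ^ p * (1 - 2 * b) ^ l * (Okamoto b y - Okamoto b x)) a -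
        a ^ p * (1 - 2 * a) ^ l * logSlope a p l ^ k * (Okamoto a y - Okamoto a x)| ≤
      a ^ p * (1 - 2 * a) ^ l * C * ((n : ℝ) ^ k / n) := by
  choose Cj hCj using fun j => exists_iteratedDeriv_Okamoto_bound ha ha' j
  have hCj0 : ∀ j, 0 ≤ Cj j := fun j => (abs_nonneg _).trans (hCj j 0)
  have hs1 : 0 < 1 - 2 * a := by linarith
  set S : ℝ := ∑ i ∈ Finset.range (k + 1),
    (|1 / a| ^ i * i ^ 2 + |(-2) / (1 - 2 * a)| ^ i * i ^ 2 + 2 * Cj i) with hS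
  have hSle : ∀ i ≤ k, |1 / a| ^ i * i ^ 2 + |(-2) / (1 - 2 * a)| ^ i * i ^ 2 + 2 * Cj i ≤ S :=
    fun i hi => Finset.single_le_sum
      (f := fun i : ℕ => |1 / a| ^ i * i ^ 2 + |(-2) / (1 - 2 * a)| ^ i * (i : ℝ) ^ 2 + 2 * Cj i)
      (fun j _ => by have := hCj0 j; positivity) (Finset.mem_range.2 (by lia))
  have hS0 : 0 ≤ S := Finset.sum_nonneg fun j _ => by have := hCj0 j; positivity
  set K : ℝ := 1 + S + |1 / a| + |(-2) / (1 - 2 * a)| with hKdef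
  have hP1 := abs_nonneg (1 / a)
  have hP2 := abs_nonneg ((-2) / (1 - 2 * a))
  have hK1 : 1 ≤ K := by linarith
  set K' : ℝ := 2 ^ k * (3 * (2 * K) ^ (k + 2)) with hK'
  have hKK' : 2 * K ≤ K' := by
    have h1 : (1:ℝ) ≤ 2 ^ k := one_le_pow₀ (by norm_num)
    have h2 : 2 * K ≤ (2 * K) ^ (k + 2) := le_self_pow₀ (by linarith) (by lia)
    nlinarith
  have hK'1 : 1 ≤ K' := by linarith
  refine ⟨2 ^ k * (3 * K' ^ (k + 2)), ?_, fun p l n hn hp hl x y => ?_⟩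
  · have h1 : (1:ℝ) ≤ 2 ^ k := one_le_pow₀ (by norm_num)
    have h2 : 1 ≤ K' ^ (k + 2) := one_le_pow₀ hK'1
    nlinarith
  have hnR : (1:ℝ) ≤ n := by exact_mod_cast hn
  have hpR : (p:ℝ) ≤ n := by exact_mod_cast hp
  have hlR : (l:ℝ) ≤ n := by exact_mod_cast hl
  have hv : |1 / a * (p : ℝ)| ≤ K * n := by
    rw [abs_mul, Nat.abs_cast]
    gcongr
    linarith
  have hw : |(-2) / (1 - 2 * a) * (l : ℝ)| ≤ K * n := by
    rw [abs_mul, Nat.abs_cast]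
    gcongr
    linarith
  have hKn : 0 < K * n := by positivity
  have hF : ∀ i ≤ k, |iteratedDeriv i (fun b : ℝ => (0 + 1 * b) ^ p) a -
      a ^ p * (1 / a * p) ^ i * 1| ≤ |a ^ p| * (2 * K) * ((n:ℝ) ^ i / n) := fun i hi => by
    rw [mul_one]
    refine (abs_iteratedDeriv_affine_pow_sub_le (by ring) ha.ne' p i hnR hpR).trans ?_
    refine mul_le_mul_of_nonneg_right (mul_le_mul_of_nonneg_left ?_ (abs_nonneg _)) (by positivity)
    have h1 := hSle i hi
    have h2 : 0 ≤ |(-2) / (1 - 2 * a)| ^ i * (i:ℝ) ^ 2 := by positivity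
    linarith [hCj0 i]
  have hG : ∀ i ≤ k, |iteratedDeriv i (fun b : ℝ => (1 + (-2) * b) ^ l) a -
      (1 - 2 * a) ^ l * ((-2) / (1 - 2 * a) * l) ^ i * 1| ≤
        |(1 - 2 * a) ^ l| * (2 * K) * ((n:ℝ) ^ i / n) := fun i hi => by
    rw [mul_one]
    refine (abs_iteratedDeriv_affine_pow_sub_le (by ring) hs1.ne' l i hnR hlR).trans ?_
    refine mul_le_mul_of_nonneg_right (mul_le_mul_of_nonneg_left ?_ (abs_nonneg _)) (by positivity)
    have h1 := hSle i hi
    have h2 : 0 ≤ |1 / a| ^ i * (i:ℝ) ^ 2 := by positivity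
    linarith [hCj0 i]
  have hFG := abs_iteratedDeriv_mul_sub_le (K := 2 * K) (by linarith) (k := k) (by fun_prop)
    (by fun_prop) hnR (hv.trans (by linarith)) (hw.trans (by linarith))
    (by rw [abs_one]; linarith) (by rw [abs_one]; linarith) hF hG
  have hcy := contDiffAt_Okamoto ha ha' y
  have hcx := contDiffAt_Okamoto ha ha' x
  have hH : ∀ i ≤ k, |iteratedDeriv i ((fun b => Okamoto b y) - fun b => Okamoto b x) a -
      1 * 0 ^ i * (Okamoto a y - Okamoto a x)| ≤ |1| * K' * ((n:ℝ) ^ i / n) := fun i hi => by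
    rw [iteratedDeriv_sub (hcy i) (hcx i), abs_one, one_mul, one_mul]
    rcases Nat.eq_zero_or_pos i with rfl | hi0
    · simp only [iteratedDeriv_zero, pow_zero, one_mul, sub_self, abs_zero]
      positivity
    · rw [zero_pow hi0.ne', zero_mul, sub_zero]
      have h1 : (1:ℝ) ≤ (n:ℝ) ^ i / n := by
        rw [one_le_div (by linarith)]
        exact le_self_pow₀ hnR hi0.ne'
      have h2 := abs_sub (iteratedDeriv i (fun b => Okamoto b y) a)
        (iteratedDeriv i (fun b => Okamoto b x) a)
      have h3 := hSle i hi
      have h4 : 0 ≤ |1 / a| ^ i * (i:ℝ) ^ 2 := by positivity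
      have h5 : 0 ≤ |(-2) / (1 - 2 * a)| ^ i * (i:ℝ) ^ 2 := by positivity
      calc _ ≤ K' * 1 := by linarith [hCj i x, hCj i y]
        _ ≤ _ := by gcongr
  have hval : |Okamoto a y - Okamoto a x| ≤ K' := by
    have h1 := Okamoto_nonneg ha ha' x
    have h2 := Okamoto_le_one ha ha' x
    have h3 := Okamoto_nonneg ha ha' y
    have h4 := Okamoto_le_one ha ha' y
    rw [abs_le]
    constructor <;> linarith
  have hvw : |1 / a * (p:ℝ) + (-2) / (1 - 2 * a) * l| ≤ K' * n := by
    refine (abs_add_le _ _).trans ?_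
    have : 2 * K * n ≤ K' * n := by gcongr
    linarith
  have hfin := abs_iteratedDeriv_mul_sub_le hK'1 (k := k)
    (f := (fun b : ℝ => (0 + 1 * b) ^ p) * fun b : ℝ => (1 + (-2) * b) ^ l)
    (g := (fun b => Okamoto b y) - fun b => Okamoto b x)
    (ContDiffAt.mul (by fun_prop) (by fun_prop)) ((hcy k).sub (hcx k)) hnR hvw
    (by rw [abs_zero]; positivity) (by rw [mul_one, abs_one]; exact hK'1) hval hFG hH k le_rfl
  have hW : |a ^ p * (1 - 2 * a) ^ l * 1| = a ^ p * (1 - 2 * a) ^ l := by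
    rw [mul_one, abs_of_pos (by positivity)]
  rw [hW] at hfin
  convert hfin using 2
  have hfun : (fun b => b ^ p * (1 - 2 * b) ^ l * (Okamoto b y - Okamoto b x)) =
      (fun b : ℝ => (0 + 1 * b) ^ p) * (fun b : ℝ => (1 + (-2) * b) ^ l) *
        ((fun b => Okamoto b y) - fun b => Okamoto b x) := by
    funext b
    simp only [Pi.mul_apply, Pi.sub_apply]
    ring
  rw [hfun, logSlope]
  ring

/-! ### Increments of `M_k` on triadic intervals -/

/-- Logarithmic derivative in `a` of the increment of `F_a` over the `n`-th triadic interval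
around `x`. -/
noncomputable def tSlope (a x : ℝ) (n : ℕ) : ℝ := logSlope a (n - lCount x n) (lCount x n)

theorem exists_Mfun_triadic_sub_bound {a : ℝ} (ha : 0 < a) (ha' : a < 1 / 2) (k : ℕ) :
    ∃ C, 1 ≤ C ∧ ∀ n : ℕ, 1 ≤ n → ∀ x ∈ Ico (0:ℝ) 1, ∀ z ∈ Icc (0:ℝ) 1, ∀ z' ∈ Icc (0:ℝ) 1,
      |Mfun k a ((⌊(3:ℝ) ^ n * x⌋ + z) / 3 ^ n) - Mfun k a ((⌊(3:ℝ) ^ n * x⌋ + z') / 3 ^ n) -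
        tWeight a x n * tSlope a x n ^ k * (Okamoto a z - Okamoto a z')| ≤
      tWeight a x n * C * ((n : ℝ) ^ k / n) := by
  obtain ⟨C, hC, h⟩ := exists_iteratedDeriv_weight_mul_bound ha ha' k
  refine ⟨C, hC, fun n hn x hx z hz z' hz' => ?_⟩
  have key := h (n - lCount x n) (lCount x n) n hn (Nat.sub_le _ _) (lCount_le x n) z' z
  rw [← tWeight_eq] at key
  convert key using 2
  congr 1
  rw [Mfun, Mfun, ← iteratedDeriv_fun_sub (contDiffAt_Okamoto ha ha' _ k)
    (contDiffAt_Okamoto ha ha' _ k)]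
  refine Filter.EventuallyEq.iteratedDeriv_eq k ?_
  filter_upwards [isOpen_Ioo.mem_nhds (show a ∈ Ioo (0:ℝ) 1 from ⟨ha, by linarith⟩)] with b hb
  rw [Okamoto_triadic_sub hb.1 hb.2 hx n hz hz', tWeight_eq]

theorem tSlope_eq {a : ℝ} (ha : 0 < a) (ha' : a < 1 / 2) (x : ℝ) (n : ℕ) :
    tSlope a x n = (n * (1 - 2 * a) - lCount x n) / (a * (1 - 2 * a)) := by
  have : 1 - 2 * a ≠ 0 := by linarith
  rw [tSlope, logSlope, Nat.cast_sub (lCount_le x n), div_sub_div _ _ ha.ne' this]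
  congr 1
  ring

theorem abs_tSlope_le {a : ℝ} (ha : 0 < a) (ha' : a < 1 / 2) (x : ℝ) (n : ℕ) :
    |tSlope a x n| ≤ 1 / (a * (1 - 2 * a)) * n := by
  have h1 : 0 < 1 - 2 * a := by linarith
  have h2 : (lCount x n : ℝ) ≤ n := by exact_mod_cast lCount_le x n
  have h3 : (0:ℝ) ≤ lCount x n := by positivity
  rw [tSlope_eq ha ha', abs_div, abs_of_pos (a := a * (1 - 2 * a)) (by positivity),
    div_mul_eq_mul_div, one_mul]
  gcongr
  rw [abs_le]
  constructor <;> nlinarith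

/-! ### Necessary conditions for infinite derivatives -/

theorem derivMInf_iff_neg {f : ℝ → ℝ} {x : ℝ} : derivMInf f x ↔ derivPInf (-f) x := by
  rw [derivMInf, derivPInf, ← tendsto_neg_atBot_iff]
  congr! 2 with y
  simp only [Pi.neg_apply]
  ring

/-- An infinite derivative forces unbounded slopes over the triadic intervals around `x`. -/
theorem eventually_one_le_triadic_slope {f : ℝ → ℝ} {x : ℝ} (hx : x ∈ Ioo (0:ℝ) 1)
    (hf : derivPInf f x) :
    ∀ᶠ n : ℕ in atTop, 1 ≤ 3 ^ n * (f ((⌊(3:ℝ) ^ n * x⌋ + 1) / 3 ^ n) -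
      f ((⌊(3:ℝ) ^ n * x⌋ + 0) / 3 ^ n)) := by
  have h1 := hf.eventually_ge_atTop 1
  rw [eventually_nhdsWithin_iff, Metric.eventually_nhds_iff] at h1
  obtain ⟨ε, hε, h1⟩ := h1
  have hlim : Tendsto (fun n : ℕ => (1 / 3 : ℝ) ^ n) atTop (𝓝 0) :=
    tendsto_pow_atTop_nhds_zero_of_lt_one (by norm_num) (by norm_num)
  filter_upwards [hlim.eventually (gt_mem_nhds hε), hlim.eventually (gt_mem_nhds hx.1),
    hlim.eventually (gt_mem_nhds (sub_pos.2 hx.2))] with n hn1 hn2 hn3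
  have hp : (0:ℝ) < 3 ^ n := by positivity
  have e1 : (1 / 3 : ℝ) ^ n = 1 / 3 ^ n := by rw [div_pow, one_pow]
  rw [e1] at hn1 hn2 hn3
  have hfl := Int.floor_le ((3:ℝ) ^ n * x)
  have hlt := Int.lt_floor_add_one ((3:ℝ) ^ n * x)
  set m : ℝ := ((⌊(3:ℝ) ^ n * x⌋ : ℤ) : ℝ) with hm
  set L : ℝ := (m + 0) / 3 ^ n with hL
  set R : ℝ := (m + 1) / 3 ^ n with hR
  have hRL : R - L = 1 / 3 ^ n := by
    rw [hL, hR]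
    ring
  have hLx : L ≤ x := by
    rw [hL, div_le_iff₀ hp]
    linarith
  have hxR : x < R := by
    rw [hR, lt_div_iff₀ hp]
    linarith
  have hgt : ∀ y ∈ Icc (0:ℝ) 1, dist y x < ε → x ≤ y → y - x ≤ f y - f x := by
    intro y hy hyx hxy
    rcases hxy.eq_or_lt with rfl | hlt
    · simp
    · have := h1 hyx ⟨hy, hlt.ne'⟩
      rwa [le_div_iff₀ (by linarith), one_mul] at this
  have hlt' : ∀ y ∈ Icc (0:ℝ) 1, dist y x < ε → y ≤ x → x - y ≤ f x - f y := by
    intro y hy hyx hxy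
    rcases hxy.eq_or_lt with rfl | hlt
    · simp
    · have := h1 hyx ⟨hy, hlt.ne⟩
      rw [le_div_iff_of_neg (by linarith), one_mul] at this
      linarith
  have a1 := hgt R ⟨by linarith [hx.1], by linarith⟩
    (by rw [Real.dist_eq, abs_of_pos (by linarith)]; linarith) hxR.le
  have a2 := hlt' L ⟨by linarith, by linarith [hx.2]⟩
    (by rw [Real.dist_eq, abs_of_nonpos (by linarith)]; linarith) hLx
  have a3 : 1 / 3 ^ n ≤ f R - f L := by linarith
  calc (1:ℝ) = 3 ^ n * (1 / 3 ^ n) := by field_simp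
    _ ≤ _ := by gcongr

/-- If `M_k` has an infinite derivative at `x`, the slopes of `F_a` around `x` cannot decay
exponentially. -/
theorem exists_one_le_of_infinite_deriv {a : ℝ} (ha : 0 < a) (ha' : a < 1 / 2) (k : ℕ) {x : ℝ}
    (hx : x ∈ Ioo (0:ℝ) 1) (h : derivPInf (Mfun k a) x ∨ derivMInf (Mfun k a) x) :
    ∃ C, 0 < C ∧ ∀ᶠ n : ℕ in atTop, 1 ≤ 3 ^ n * tWeight a x n * (C * (n : ℝ) ^ k) := by
  obtain ⟨C, hC, hM⟩ := exists_Mfun_triadic_sub_bound ha ha' k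
  have h2a : 0 < 1 - 2 * a := by linarith
  refine ⟨C + (1 / (a * (1 - 2 * a))) ^ k, by positivity, ?_⟩
  have key : ∀ᶠ n : ℕ in atTop, 1 ≤ 3 ^ n * |Mfun k a ((⌊(3:ℝ) ^ n * x⌋ + 1) / 3 ^ n) -
      Mfun k a ((⌊(3:ℝ) ^ n * x⌋ + 0) / 3 ^ n)| := by
    rcases h with h | h
    · filter_upwards [eventually_one_le_triadic_slope hx h] with n hn
      refine hn.trans ?_
      gcongr
      exact le_abs_self _
    · filter_upwards [eventually_one_le_triadic_slope hx (derivMInf_iff_neg.1 h)] with n hn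
      refine hn.trans ?_
      gcongr
      simp only [Pi.neg_apply]
      rw [neg_sub_neg, abs_sub_comm]
      exact le_abs_self _
  filter_upwards [key, eventually_ge_atTop 1] with n hn hn1
  refine hn.trans ?_
  have hb := hM n hn1 x ⟨hx.1.le, hx.2⟩ 1 (by simp) 0 (by simp)
  rw [Okamoto_one ha (by linarith), Okamoto_zero, sub_zero, mul_one] at hb
  have hW := tWeight_pos ha ha' x n
  have hn1' : (1:ℝ) ≤ n := by exact_mod_cast hn1
  have h1 : (n:ℝ) ^ k / n ≤ n ^ k := div_le_self (by positivity) hn1'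
  have h2 : |tSlope a x n| ^ k ≤ (1 / (a * (1 - 2 * a)) * n) ^ k := by
    gcongr
    exact abs_tSlope_le ha ha' x n
  rw [mul_assoc]
  gcongr
  set D := Mfun k a ((⌊(3:ℝ) ^ n * x⌋ + 1) / 3 ^ n) - Mfun k a ((⌊(3:ℝ) ^ n * x⌋ + 0) / 3 ^ n)
  have h3 := abs_add_le (D - tWeight a x n * tSlope a x n ^ k) (tWeight a x n * tSlope a x n ^ k)
  rw [sub_add_cancel, abs_mul, abs_pow, abs_of_pos hW] at h3
  calc |D| ≤ tWeight a x n * C * (n ^ k / n) + tWeight a x n * |tSlope a x n| ^ k := by linarith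
    _ ≤ tWeight a x n * C * n ^ k + tWeight a x n * (1 / (a * (1 - 2 * a)) * n) ^ k := by gcongr
    _ = _ := by rw [mul_pow]; ring

theorem eventually_neg_le_tSlope {a : ℝ} (ha : 0 < a) (ha' : a < 1 / 2) {k : ℕ} (hk : Odd k)
    {x : ℝ} (hx : x ∈ Ioo (0:ℝ) 1) (σ : ℝ) (hσ : |σ| = 1) (h : derivPInf (σ • Mfun k a) x)
    {δ : ℝ} (hδ : 0 < δ) : ∀ᶠ n : ℕ in atTop, -(δ * n) ≤ σ * tSlope a x n := by
  obtain ⟨C, hC, hM⟩ := exists_Mfun_triadic_sub_bound ha ha' k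
  filter_upwards [eventually_one_le_triadic_slope hx h, eventually_ge_atTop 1,
    (tendsto_natCast_atTop_atTop (R := ℝ)).eventually_gt_atTop (C / δ ^ k)] with n hn hn1 hn2
  by_contra! hcon
  have hb := hM n hn1 x ⟨hx.1.le, hx.2⟩ 1 (by simp) 0 (by simp)
  rw [Okamoto_one ha (by linarith), Okamoto_zero, sub_zero, mul_one] at hb
  have hW := tWeight_pos ha ha' x n
  have hn1' : (1:ℝ) ≤ n := by exact_mod_cast hn1
  simp only [Pi.smul_apply, smul_eq_mul, ← mul_sub] at hn
  set D := Mfun k a ((⌊(3:ℝ) ^ n * x⌋ + 1) / 3 ^ n) - Mfun k a ((⌊(3:ℝ) ^ n * x⌋ + 0) / 3 ^ n)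
  have hσk : σ ^ k = σ := by
    rcases (abs_eq (by norm_num)).1 hσ with rfl | rfl
    · simp
    · exact hk.neg_one_pow
  have h1 : σ * tSlope a x n ^ k ≤ -((δ * n) ^ k) := by
    have : (δ * n) ^ k ≤ (-(σ * tSlope a x n)) ^ k := by
      gcongr
      linarith
    rw [hk.neg_pow, mul_pow σ, hσk] at this
    linarith
  have h2 : σ * D ≤ tWeight a x n * (σ * tSlope a x n ^ k) +
      tWeight a x n * C * ((n : ℝ) ^ k / n) := by
    have : |σ * (D - tWeight a x n * tSlope a x n ^ k)| ≤
        tWeight a x n * C * ((n : ℝ) ^ k / n) := by rwa [abs_mul, hσ, one_mul]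
    have := (le_abs_self _).trans this
    linarith
  have h3 : C * ((n : ℝ) ^ k / n) ≤ (δ * n) ^ k := by
    rw [div_lt_iff₀ (by positivity)] at hn2
    rw [mul_pow, mul_div_assoc', div_le_iff₀ (by linarith)]
    have : (0:ℝ) ≤ n ^ k := by positivity
    nlinarith
  have h4 : tWeight a x n * (σ * tSlope a x n ^ k + C * ((n : ℝ) ^ k / n)) ≤ 0 :=
    mul_nonpos_of_nonneg_of_nonpos hW.le (by linarith)
  have h5 : (0:ℝ) < 3 ^ n := by positivity
  nlinarith

/-! ### Sufficient conditions for infinite derivatives -/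

theorem tShift_pos_of_digit {x : ℝ} (hx : x ∈ Ico (0:ℝ) 1) {n i : ℕ} (h : tDigit x (n + i) = 1) :
    0 < tShift x n := by
  refine (tShift_mem x n).1.lt_of_ne fun h0 => ?_
  rw [← tDigit_tShift hx, ← h0] at h
  simp [tDigit] at h

theorem eventually_floor_eq {x : ℝ} (n : ℕ) (h : 0 < tShift x n) :
    ∀ᶠ y in 𝓝 x, ⌊(3:ℝ) ^ n * y⌋ = ⌊(3:ℝ) ^ n * x⌋ := by
  have h1 : ((⌊(3:ℝ) ^ n * x⌋ : ℤ) : ℝ) < 3 ^ n * x := by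
    have : tShift x n = 3 ^ n * x - ⌊(3:ℝ) ^ n * x⌋ := rfl
    linarith
  have hc : Tendsto (fun y : ℝ => (3:ℝ) ^ n * y) (𝓝 x) (𝓝 (3 ^ n * x)) :=
    tendsto_id.const_mul _
  filter_upwards [hc.eventually (lt_mem_nhds h1),
    hc.eventually (gt_mem_nhds (Int.lt_floor_add_one ((3:ℝ) ^ n * x)))] with y h2 h3
  exact Int.floor_eq_iff.2 ⟨h2.le, h3⟩

theorem exists_floor_ne {x y : ℝ} (hxy : x ≠ y) :
    ∃ N : ℕ, ∀ n ≥ N, ⌊(3:ℝ) ^ n * y⌋ ≠ ⌊(3:ℝ) ^ n * x⌋ := by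
  have h0 : 0 < |y - x| := abs_pos.2 (sub_ne_zero.2 hxy.symm)
  obtain ⟨N, hN⟩ := pow_unbounded_of_one_lt (1 / |y - x|) (by norm_num : (1:ℝ) < 3)
  refine ⟨N, fun n hn h => ?_⟩
  have h1 := Int.abs_sub_lt_one_of_floor_eq_floor h
  rw [← mul_sub, abs_mul, abs_of_pos (by positivity : (0:ℝ) < 3 ^ n)] at h1
  rw [div_lt_iff₀ h0] at hN
  have : (3:ℝ) ^ N ≤ 3 ^ n := pow_le_pow_right₀ (by norm_num) hn
  nlinarith

theorem exists_first_difference {x y : ℝ} (hxy : x ≠ y) {m : ℕ}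
    (hm : ⌊(3:ℝ) ^ m * y⌋ = ⌊(3:ℝ) ^ m * x⌋) :
    ∃ n ≥ m, ⌊(3:ℝ) ^ n * y⌋ = ⌊(3:ℝ) ^ n * x⌋ ∧
      ⌊(3:ℝ) ^ (n + 1) * y⌋ ≠ ⌊(3:ℝ) ^ (n + 1) * x⌋ := by
  by_contra! hcon
  obtain ⟨N, hN⟩ := exists_floor_ne hxy
  have : ∀ j, ⌊(3:ℝ) ^ (m + j) * y⌋ = ⌊(3:ℝ) ^ (m + j) * x⌋ := fun j => by
    induction j with
    | zero => exact hm
    | succ j ih => exact hcon (m + j) (by lia) ih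
  exact hN (m + N) (by lia) (this N)

theorem tendsto_quotient_of_bounded_runs {a : ℝ} (ha : 0 < a) (ha' : a < 1 / 2) {k : ℕ}
    (hk : 1 ≤ k) {x : ℝ} (hx : x ∈ Ico (0:ℝ) 1) {J : ℕ}
    (hJ : ∀ n, ∃ i < J, tDigit x (n + (i + 1)) = 1) {c θ σ : ℝ} (hc : 0 < c) (hθ : 0 < θ)
    (hσ : |σ| = 1) (hW : ∀ n, c ≤ 3 ^ n * tWeight a x n)
    (hu : ∀ᶠ n : ℕ in atTop, θ * (n : ℝ) ^ k ≤ σ * tSlope a x n ^ k) :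
    Tendsto (fun y => σ * ((Mfun k a y - Mfun k a x) / (y - x))) (𝓝[Icc 0 1 \ {x}] x) atTop := by
  obtain ⟨C, hC, hM⟩ := exists_Mfun_triadic_sub_bound ha ha' k
  set ρ : ℝ := min a (1 - 2 * a) with hρ
  have hρ0 : 0 < ρ := lt_min ha (by linarith)
  have hρ1 : ρ ≤ 1 := (min_le_left _ _).trans (by linarith)
  set γ : ℝ := ρ ^ (J + 1) with hγ
  have hγ0 : 0 < γ := by positivity
  rw [tendsto_atTop]
  intro B
  obtain ⟨m, hm⟩ := eventually_atTop.1 (hu.and ((eventually_ge_atTop 1).and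
    (((tendsto_natCast_atTop_atTop (R := ℝ)).eventually_ge_atTop (2 * C / (θ * γ))).and
      ((tendsto_natCast_atTop_atTop (R := ℝ)).eventually_ge_atTop (2 * B / (c * θ * γ))))))
  obtain ⟨i₀, -, hi₀⟩ := hJ m
  have hev := eventually_floor_eq m (tShift_pos_of_digit hx hi₀)
  filter_upwards [eventually_nhdsWithin_of_eventually_nhds hev,
    eventually_nhdsWithin_of_eventually_nhds (gt_mem_nhds hx.2), self_mem_nhdsWithin]
    with y hy1 hy2 hy3
  have hy : y ∈ Ico (0:ℝ) 1 := ⟨hy3.1.1, hy2⟩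
  have hne : x ≠ y := fun h => hy3.2 h.symm
  obtain ⟨n, hnm, hn1, hn2⟩ := exists_first_difference hne hy1
  obtain ⟨hun, hn0, hnC, hnB⟩ := hm n hnm
  have hnR : (1:ℝ) ≤ n := by exact_mod_cast hn0
  have hdx := floor_three_pow_succ (ne_one_of_mem_Ico hx) n
  have hdy := floor_three_pow_succ (ne_one_of_mem_Ico hy) n
  have hWp := tWeight_pos ha ha' x n
  have hxe := eq_floor_add_tShift x n
  have hye := eq_floor_add_tShift y n
  rw [hn1] at hye
  obtain ⟨i, hiJ, hi⟩ := hJ n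
  rw [← tDigit_tShift hx] at hi
  have hgap := Okamoto_gap ha ha' hρ0 (min_le_left _ _) (min_le_right _ _) (tShift_mem x n)
    (tShift_mem y n) hi
  have hd0 : tDigit (tShift x n) 0 = tDigit x n := tDigit_tShift hx n 0
  have hd0' : tDigit (tShift y n) 0 = tDigit y n := tDigit_tShift hy n 0
  rw [hd0, hd0'] at hgap
  have hγi : γ ≤ ρ ^ (i + 2) := pow_le_pow_of_le_one hρ0.le hρ1 (by lia)
  have hbound := hM n hn0 x hx (tShift y n) (Ico_subset_Icc_self (tShift_mem y n)) (tShift x n)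
    (Ico_subset_Icc_self (tShift_mem x n))
  rw [← hxe, ← hye] at hbound
  have core : ∀ g D : ℝ, |D - tWeight a x n * tSlope a x n ^ k * g| ≤
      tWeight a x n * C * ((n : ℝ) ^ k / n) → γ ≤ g →
      tWeight a x n * (n ^ k * (θ * γ / 2)) ≤ σ * D := by
    intro g D hD hg
    have h1 : |σ * (D - tWeight a x n * tSlope a x n ^ k * g)| ≤
        tWeight a x n * C * ((n : ℝ) ^ k / n) := by rwa [abs_mul, hσ, one_mul]
    have h2 := (abs_le.1 h1).1
    have h3 : C * ((n:ℝ) ^ k / n) ≤ n ^ k * (θ * γ / 2) := by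
      rw [div_le_iff₀ (by positivity)] at hnC
      rw [mul_div_assoc', div_le_iff₀ (by linarith)]
      have : (0:ℝ) ≤ n ^ k := by positivity
      nlinarith
    have hpos : 0 ≤ σ * tSlope a x n ^ k := le_trans (by positivity) hun
    have h4 : θ * (n:ℝ) ^ k * γ ≤ σ * tSlope a x n ^ k * g := by gcongr
    have h5 : tWeight a x n * (θ * (n:ℝ) ^ k * γ) ≤ tWeight a x n * (σ * tSlope a x n ^ k * g) := by
      gcongr
    have h6 : tWeight a x n * (C * ((n:ℝ) ^ k / n)) ≤ tWeight a x n * (n ^ k * (θ * γ / 2)) := by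
      gcongr
    linarith
  have hlast : ∀ D t : ℝ, 0 < t → t ≤ 1 / 3 ^ n →
      tWeight a x n * (n ^ k * (θ * γ / 2)) ≤ D → B ≤ D / t := by
    intro D t ht ht' hD
    have hp : (0:ℝ) < 3 ^ n := by positivity
    have hnk : (n:ℝ) ≤ n ^ k := le_self_pow₀ hnR (by lia)
    calc B ≤ c * (n * (θ * γ / 2)) := by
          rw [div_le_iff₀ (by positivity)] at hnB
          linarith
      _ ≤ 3 ^ n * tWeight a x n * (n ^ k * (θ * γ / 2)) := by
          gcongr
          exact hW n
      _ = tWeight a x n * (n ^ k * (θ * γ / 2)) / (1 / 3 ^ n) := by field_simp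
      _ ≤ D / t := by
          gcongr
          exact le_trans (by positivity) hD
  have hdist : |y - x| ≤ 1 / 3 ^ n := by
    have h1 := Int.abs_sub_lt_one_of_floor_eq_floor hn1
    rw [← mul_sub, abs_mul, abs_of_pos (by positivity : (0:ℝ) < 3 ^ n)] at h1
    rw [le_div_iff₀ (by positivity)]
    linarith
  rcases hne.lt_or_gt with hlt | hgt
  · have hmono : ⌊(3:ℝ) ^ (n + 1) * x⌋ ≤ ⌊(3:ℝ) ^ (n + 1) * y⌋ := Int.floor_mono (by gcongr)
    have hdig : tDigit x n < tDigit y n := by lia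
    rw [abs_of_pos (by linarith)] at hdist
    rw [← mul_div_assoc]
    exact hlast _ _ (by linarith) hdist (core _ _ hbound (hγi.trans (hgap.1 hdig)))
  · have hmono : ⌊(3:ℝ) ^ (n + 1) * y⌋ ≤ ⌊(3:ℝ) ^ (n + 1) * x⌋ := Int.floor_mono (by gcongr)
    have hdig : tDigit y n < tDigit x n := by lia
    rw [abs_of_neg (by linarith), neg_sub] at hdist
    rw [← neg_sub (Mfun k a x), ← neg_sub x, neg_div_neg_eq, ← mul_div_assoc]
    refine hlast _ _ (by linarith) hdist (core (Okamoto a (tShift x n) - Okamoto a (tShift y n)) _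
      ?_ (hγi.trans (hgap.2 hdig)))
    rw [← abs_neg]
    convert hbound using 2
    ring

/-! ### Upper bounds for the dimension -/

theorem floor_three_pow_eq {x y : ℝ} (hx : x ∈ Ico (0:ℝ) 1) (hy : y ∈ Ico (0:ℝ) 1) {n : ℕ}
    (h : ∀ i < n, tDigit x i = tDigit y i) : ⌊(3:ℝ) ^ n * x⌋ = ⌊(3:ℝ) ^ n * y⌋ := by
  induction n with
  | zero => simp [Int.floor_eq_zero_iff.2 hx, Int.floor_eq_zero_iff.2 hy]
  | succ n ih =>
    rw [floor_three_pow_succ (ne_one_of_mem_Ico hx), floor_three_pow_succ (ne_one_of_mem_Ico hy),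
      ih fun i hi => h i (by lia), h n (by lia)]

theorem abs_sub_le_of_tDigit_eq {x y : ℝ} (hx : x ∈ Ico (0:ℝ) 1) (hy : y ∈ Ico (0:ℝ) 1) {n : ℕ}
    (h : ∀ i < n, tDigit x i = tDigit y i) : |x - y| ≤ 1 / 3 ^ n := by
  have h1 := eq_floor_add_tShift x n
  have h2 := eq_floor_add_tShift y n
  have h3 := tShift_mem x n
  have h4 := tShift_mem y n
  have : x - y = (tShift x n - tShift y n) / 3 ^ n := by
    rw [floor_three_pow_eq hx hy h] at h1
    linear_combination h1 - h2
  rw [this, abs_div, abs_of_pos (a := (3:ℝ) ^ n) (by positivity)]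
  gcongr
  exact abs_le.2 ⟨by linarith [h3.1, h4.2], by linarith [h3.2, h4.1]⟩

theorem dimH_tWeight_le {b s : ℝ} (hb : 0 < b) (hb' : b < 1 / 2) (hs : 0 < s) :
    dimH {x ∈ Ioo (0:ℝ) 1 | ∀ᶠ n : ℕ in atTop, (3:ℝ) ^ (-(s * n)) ≤ tWeight b x n} ≤
      ENNReal.ofReal s := by
  let S : ℕ → Set ℝ := fun N => {x ∈ Ioo (0:ℝ) 1 | ∀ n ≥ N, (3:ℝ) ^ (-(s * n)) ≤ tWeight b x n}
  have hS : {x ∈ Ioo (0:ℝ) 1 | ∀ᶠ n : ℕ in atTop, (3:ℝ) ^ (-(s * n)) ≤ tWeight b x n} ⊆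
      ⋃ N, S N := by
    rintro x ⟨hx, h⟩
    obtain ⟨N, hN⟩ := eventually_atTop.1 h
    exact mem_iUnion.2 ⟨N, hx, hN⟩
  refine (dimH_mono hS).trans ?_
  rw [dimH_iUnion]
  refine iSup_le fun N => ?_
  let t : ∀ n : ℕ, (Fin n → Fin 3) → Set ℝ :=
    fun n w => {x ∈ S N | ∀ i : Fin n, tDigit x i = (w i : ℕ)}
  have hdiam : ∀ n w, Metric.ediam (t n w) ≤ ENNReal.ofReal (1 / 3 ^ n) := by
    intro n w
    refine Metric.ediam_le fun x hx y hy => ?_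
    rw [edist_dist, Real.dist_eq]
    refine ENNReal.ofReal_le_ofReal (abs_sub_le_of_tDigit_eq (Ioo_subset_Ico_self hx.1.1)
      (Ioo_subset_Ico_self hy.1.1) fun i hi => ?_)
    exact (hx.2 ⟨i, hi⟩).trans (hy.2 ⟨i, hi⟩).symm
  have hcard : ∀ n, ∑ w : Fin n → Fin 3, ∏ i, rDig b (w i) = 1 := by
    intro n
    rw [← Fintype.sum_pow (fun d : Fin 3 => rDig b d) n, Fin.sum_univ_three]
    rw [show rDig b (0 : Fin 3) + rDig b (1 : Fin 3) + rDig b (2 : Fin 3) = 1 by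
      simp only [rDig]
      norm_num
      ring, one_pow]
  have hterm : ∀ n ≥ N, ∀ w, Metric.ediam (t n w) ^ s ≤ ENNReal.ofReal (∏ i, rDig b (w i)) := by
    intro n hn w
    rcases (t n w).eq_empty_or_nonempty with h | ⟨x, hx⟩
    · rw [h, Metric.ediam_empty, ENNReal.zero_rpow_of_pos hs]
      exact zero_le
    refine (ENNReal.rpow_le_rpow (hdiam n w) hs.le).trans ?_
    rw [ENNReal.ofReal_rpow_of_nonneg (by positivity) hs.le]
    refine ENNReal.ofReal_le_ofReal ?_
    have h1 := hx.1.2 n hn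
    rw [tWeight, Finset.prod_range] at h1
    simp only [hx.2] at h1
    convert h1 using 1
    rw [one_div, ← Real.rpow_natCast, ← Real.rpow_neg (by norm_num), ← Real.rpow_mul (by norm_num)]
    ring_nf
  have hH : μH[s] (S N) ≤ 1 := by
    refine (Measure.hausdorffMeasure_le_liminf_sum s (S N) (l := atTop)
      (fun n : ℕ => ENNReal.ofReal (1 / 3 ^ n)) ?_ t (Eventually.of_forall hdiam) ?_).trans ?_
    · rw [← ENNReal.ofReal_zero]
      refine ENNReal.tendsto_ofReal ?_
      simpa using tendsto_pow_atTop_nhds_zero_of_lt_one (r := (3:ℝ)⁻¹) (by norm_num) (by norm_num)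
    · refine Eventually.of_forall fun n x hx => mem_iUnion.2
        ⟨fun i => ⟨tDigit x i, Nat.lt_succ_of_le (tDigit_le_two x i)⟩, hx, fun i => rfl⟩
    · refine liminf_le_of_le (by isBoundedDefault) fun c hc => ?_
      obtain ⟨n, hn, hnN⟩ := (hc.and (eventually_ge_atTop N)).exists
      refine hn.trans ((Finset.sum_le_sum fun w _ => hterm n hnN w).trans ?_)
      rw [← ENNReal.ofReal_sum_of_nonneg, hcard, ENNReal.ofReal_one]
      exact fun w _ => Finset.prod_nonneg fun i _ => (rDig_pos hb hb' _).le
  refine dimH_le_of_hausdorffMeasure_ne_top (d := s.toNNReal) ?_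
  rw [Real.coe_toNNReal s hs.le]
  exact ne_top_of_le_ne_top ENNReal.one_ne_top hH

/-! ### The entropy function -/

theorem hEnt_eq (p : ℝ) : hEnt p = Real.qaryEntropy 3 (1 - p) / Real.log 3 := by
  rw [hEnt, Real.qaryEntropy, Real.binEntropy_one_sub,
    Real.binEntropy_eq_negMulLog_add_negMulLog_one_sub]
  simp only [Real.negMulLog]
  norm_num
  ring

theorem log_three_pos : 0 < Real.log 3 := Real.log_pos (by norm_num)

theorem continuous_hEnt : Continuous hEnt := by
  have : hEnt = fun p => Real.qaryEntropy 3 (1 - p) / Real.log 3 := funext hEnt_eq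
  rw [this]
  fun_prop

theorem hEnt_nonneg {p : ℝ} (h0 : 0 ≤ p) (h1 : p ≤ 1) : 0 ≤ hEnt p := by
  rw [hEnt_eq]
  exact div_nonneg (Real.qaryEntropy_nonneg (by linarith) (by linarith)) log_three_pos.le

theorem hEnt_strictMonoOn : StrictMonoOn hEnt (Icc 0 (1 / 3)) := by
  intro p hp q hq hpq
  rw [hEnt_eq, hEnt_eq]
  refine div_lt_div_of_pos_right (Real.qaryEntropy_strictAntiOn (q := 3) (by norm_num) ?_ ?_ ?_)
    log_three_pos
  · exact ⟨by norm_num; linarith [hq.2], by linarith [hq.1]⟩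
  · exact ⟨by norm_num; linarith [hp.2], by linarith [hp.1]⟩
  · linarith

theorem hEnt_strictAntiOn : StrictAntiOn hEnt (Icc (1 / 3) 1) := by
  intro p hp q hq hpq
  rw [hEnt_eq, hEnt_eq]
  refine div_lt_div_of_pos_right (Real.qaryEntropy_strictMonoOn (q := 3) (by norm_num) ?_ ?_ ?_)
    log_three_pos
  · exact ⟨by linarith [hq.2], by norm_num; linarith [hq.1]⟩
  · exact ⟨by linarith [hp.2], by norm_num; linarith [hp.1]⟩
  · linarith

theorem hEnt_third : hEnt (1 / 3) = 1 := by
  rw [hEnt, div_eq_one_iff_eq log_three_pos.ne', show (1:ℝ) - 1 / 3 = 2 / 3 by norm_num,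
    Real.log_div (by norm_num) (by norm_num), Real.log_div (by norm_num) (by norm_num),
    Real.log_one]
  ring

theorem hEnt_mul_log_three {q : ℝ} (hq1 : q < 1) :
    (1 - q) * Real.log ((1 - q) / 2) + q * Real.log q = -(hEnt q * Real.log 3) := by
  rw [hEnt, div_mul_cancel₀ _ log_three_pos.ne', Real.log_div (by linarith) (by norm_num)]
  ring

/-- The Gibbs inequality for the probability vectors `(a, 1 - 2a, a)` and `(1/3, 1/3, 1/3)`. -/
theorem log_gibbs {a : ℝ} (ha : 0 < a) (ha' : a < 1 / 2) (h : a ≠ 1 / 3) :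
    2 * Real.log (3 * a) + Real.log (3 * (1 - 2 * a)) < 0 ∧
    0 < 2 * a * Real.log (3 * a) + (1 - 2 * a) * Real.log (3 * (1 - 2 * a)) := by
  have hb : 0 < 1 - 2 * a := by linarith
  have hb' : 3 * (1 - 2 * a) ≠ 1 := fun h' => h (by linarith)
  have ha3 : 3 * a ≠ 1 := fun h' => h (by linarith)
  have h1 := Real.log_lt_sub_one_of_pos (x := 3 * a) (by positivity) ha3
  have h2 := Real.log_lt_sub_one_of_pos (x := 3 * (1 - 2 * a)) (by positivity) hb'
  have h3 := Real.log_lt_sub_one_of_pos (x := (3 * a)⁻¹) (by positivity)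
    (by rwa [ne_eq, inv_eq_one])
  have h4 := Real.log_lt_sub_one_of_pos (x := (3 * (1 - 2 * a))⁻¹) (by positivity)
    (by rwa [ne_eq, inv_eq_one])
  rw [Real.log_inv] at h3 h4
  refine ⟨by linarith, ?_⟩
  have h5 := mul_lt_mul_of_pos_left h3 (show 0 < 2 * a by linarith)
  have h6 := mul_lt_mul_of_pos_left h4 hb
  have h7 : 2 * a * ((3 * a)⁻¹ - 1) + (1 - 2 * a) * ((3 * (1 - 2 * a))⁻¹ - 1) = 0 := by
    field_simp
    ring
  linarith

theorem phiOk_mul {a : ℝ} (ha : 0 < a) (ha' : a < 1 / 2) :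
    phiOk a * (Real.log a - Real.log (1 - 2 * a)) = Real.log (3 * a) := by
  have hb : 0 < 1 - 2 * a := by linarith
  by_cases h : a = 1 / 3
  · subst h
    norm_num
  rw [phiOk, if_neg h, if_neg ha'.ne, abs_of_pos hb, div_mul_cancel₀]
  intro h0
  exact h (by linarith [Real.log_injOn_pos ha hb (sub_eq_zero.1 h0)])

theorem phiOk_mul_three {a : ℝ} (ha : 0 < a) (ha' : a < 1 / 2) :
    phiOk a * (Real.log (3 * a) - Real.log (3 * (1 - 2 * a))) = Real.log (3 * a) := by
  nth_rewrite 2 [← phiOk_mul ha ha']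
  rw [Real.log_mul (by norm_num) ha.ne', Real.log_mul (by norm_num) (by linarith)]
  ring

theorem phiOk_mem_of_lt {a : ℝ} (ha : 0 < a) (h : a < 1 / 3) :
    1 / 3 < phiOk a ∧ phiOk a < 1 - 2 * a := by
  obtain ⟨h1, h2⟩ := log_gibbs ha (by linarith) h.ne
  have h3 := phiOk_mul_three ha (by linarith)
  have h4 : Real.log (3 * a) < 0 := Real.log_neg (by linarith) (by linarith)
  have h5 : 0 < Real.log (3 * (1 - 2 * a)) := Real.log_pos (by linarith)
  constructor <;> nlinarith

theorem phiOk_mem_of_gt {a : ℝ} (ha' : a < 1 / 2) (h : 1 / 3 < a) :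
    1 - 2 * a < phiOk a ∧ phiOk a < 1 / 3 := by
  obtain ⟨h1, h2⟩ := log_gibbs (by linarith) ha' h.ne'
  have h3 := phiOk_mul_three (by linarith) ha'
  have h4 : 0 < Real.log (3 * a) := Real.log_pos (by linarith)
  have h5 : Real.log (3 * (1 - 2 * a)) < 0 := Real.log_neg (by linarith) (by linarith)
  constructor <;> nlinarith

theorem phiOk_third : phiOk (1 / 3) = 1 / 3 := by simp [phiOk]

theorem dTilde_lt_dOk {a : ℝ} (ha : 0 < a) (ha' : a < 1 / 2) (h : a ≠ 1 / 3) :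
    dTilde a < dOk a := by
  rcases h.lt_or_gt with h | h
  · obtain ⟨h1, h2⟩ := phiOk_mem_of_lt ha h
    exact hEnt_strictAntiOn ⟨h1.le, by linarith⟩ ⟨by linarith, by linarith⟩ h2
  · obtain ⟨h1, h2⟩ := phiOk_mem_of_gt ha' h
    exact hEnt_strictMonoOn ⟨by linarith, by linarith⟩ ⟨by linarith, h2.le⟩ h1

/-! ### Upper bounds for the sets of infinite derivatives -/

theorem log_tWeight {a : ℝ} (ha : 0 < a) (ha' : a < 1 / 2) (x : ℝ) (n : ℕ) :
    Real.log (tWeight a x n) =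
      (n - lCount x n) * Real.log a + lCount x n * Real.log (1 - 2 * a) := by
  have hb : 0 < 1 - 2 * a := by linarith
  rw [tWeight_eq, Real.log_mul (by positivity) (by positivity), Real.log_pow, Real.log_pow,
    Nat.cast_sub (lCount_le x n)]

theorem dimH_le_hEnt {q : ℝ} (hq : 0 < q) (hq1 : q < 1) {A : Set ℝ} (hA : A ⊆ Ioo 0 1)
    (h : ∀ x ∈ A, ∀ ε > 0, ∀ᶠ n : ℕ in atTop,
      -(ε * n) ≤ (Real.log q - Real.log ((1 - q) / 2)) * (lCount x n - q * n)) :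
    dimH A ≤ ENNReal.ofReal (hEnt q) := by
  refine ENNReal.le_of_forall_pos_le_add fun ε hε _ => ?_
  have hε' : (0:ℝ) < ε := hε
  have hh := hEnt_nonneg hq.le hq1.le
  rw [← ENNReal.ofReal_coe_nnreal, ← ENNReal.ofReal_add hh hε'.le]
  refine le_trans (dimH_mono fun x hx => mem_sep (hA hx) ?_)
    (dimH_tWeight_le (b := (1 - q) / 2) (by linarith) (by linarith) (by linarith))
  filter_upwards [h x hx (ε * Real.log 3) (mul_pos hε' log_three_pos)] with n hn
  rw [Real.rpow_def_of_pos (by norm_num), ← Real.le_log_iff_exp_le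
    (tWeight_pos (by linarith) (by linarith) x n), log_tWeight (by linarith) (by linarith)]
  have h1 := hEnt_mul_log_three hq1
  rw [show 1 - 2 * ((1 - q) / 2) = q by ring]
  nlinarith

theorem exists_pos_mul_log_sub {a q : ℝ} (ha : 0 < a) (ha' : a < 1 / 2) (hq : 0 < q) (hq1 : q < 1)
    (h : a < 1 / 3 ∧ 1 / 3 < q ∨ 1 / 3 < a ∧ q < 1 / 3) :
    ∃ c > 0, Real.log q - Real.log ((1 - q) / 2) = c * (Real.log (1 - 2 * a) - Real.log a) := by
  have hb : 0 < 1 - 2 * a := by linarith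
  refine ⟨(Real.log q - Real.log ((1 - q) / 2)) / (Real.log (1 - 2 * a) - Real.log a), ?_, ?_⟩
  · rcases h with ⟨h, h'⟩ | ⟨h, h'⟩
    · exact div_pos (sub_pos.2 (Real.log_lt_log (by linarith) (by linarith)))
        (sub_pos.2 (Real.log_lt_log (by linarith) (by linarith)))
    · exact div_pos_of_neg_of_neg (sub_neg.2 (Real.log_lt_log (by linarith) (by linarith)))
        (sub_neg.2 (Real.log_lt_log (by linarith) (by linarith)))
  · rw [div_mul_cancel₀]
    intro h0
    have := Real.log_injOn_pos hb ha (sub_eq_zero.1 h0)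
    rcases h with h | h <;> linarith [h.1]

theorem eventually_log_mul_pow_le {C ε : ℝ} (hC : 0 < C) (hε : 0 < ε) (k : ℕ) :
    ∀ᶠ n : ℕ in atTop, Real.log (C * (n : ℝ) ^ k) ≤ ε * n := by
  have h1 : Tendsto (fun x : ℝ => x ^ k / Real.exp (ε * x)) atTop (𝓝 0) := by
    exact (isLittleO_pow_exp_pos_mul_atTop k hε).tendsto_div_nhds_zero
  have h2 := (h1.comp tendsto_natCast_atTop_atTop).eventually_le_const
    (show (0:ℝ) < 1 / C by positivity)
  filter_upwards [h2, eventually_ge_atTop 1] with n hn hn1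
  have : (1:ℝ) ≤ n := by exact_mod_cast hn1
  rw [Real.log_le_iff_le_exp (by positivity)]
  rw [Function.comp, div_le_div_iff₀ (by positivity) hC] at hn
  linarith

theorem dimH_DPlus_union_DMinus_le {k : ℕ} {a : ℝ} (ha : 0 < a) (ha' : a < 1 / 2) :
    dimH (DPlus k a ∪ DMinus k a) ≤ ENNReal.ofReal (dOk a) := by
  by_cases h3 : a = 1 / 3
  · rw [dOk, h3, phiOk_third, hEnt_third, ENNReal.ofReal_one, ← Real.dimH_univ]
    exact dimH_mono (subset_univ _)
  obtain ⟨hq, hq1, h⟩ : 0 < phiOk a ∧ phiOk a < 1 ∧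
      (a < 1 / 3 ∧ 1 / 3 < phiOk a ∨ 1 / 3 < a ∧ phiOk a < 1 / 3) := by
    rcases Ne.lt_or_gt h3 with h | h
    · have := phiOk_mem_of_lt ha h
      exact ⟨by linarith, by linarith, Or.inl ⟨h, this.1⟩⟩
    · have := phiOk_mem_of_gt ha' h
      exact ⟨by linarith, by linarith, Or.inr ⟨h, this.2⟩⟩
  obtain ⟨c, hc, hc'⟩ := exists_pos_mul_log_sub ha ha' hq hq1 h
  refine dimH_le_hEnt hq hq1 (union_subset (fun x hx => hx.1) fun x hx => hx.1)
    fun x hx ε hε => ?_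
  obtain ⟨C, hC, hev⟩ := exists_one_le_of_infinite_deriv ha ha' k (hx.elim And.left And.left)
    (hx.imp And.right And.right)
  filter_upwards [hev, eventually_log_mul_pow_le hC (div_pos hε hc) k,
    eventually_ge_atTop 1] with n hn hn' hn1
  have hn0 : (1:ℝ) ≤ n := by exact_mod_cast hn1
  have hW := tWeight_pos ha ha' x n
  have h1 := Real.log_nonneg hn
  rw [Real.log_mul (by positivity) (by positivity), Real.log_mul (by positivity) (by positivity),
    Real.log_pow, log_tWeight ha ha'] at h1
  have h2 := phiOk_mul ha ha'
  rw [Real.log_mul (by norm_num) ha.ne'] at h2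
  rw [hc']
  have h4 : -(ε / c * n) ≤ (Real.log (1 - 2 * a) - Real.log a) * (lCount x n - phiOk a * n) := by
    have : (n:ℝ) * (phiOk a * (Real.log a - Real.log (1 - 2 * a))) =
      n * (Real.log 3 + Real.log a) := by rw [h2]
    linarith
  have h5 := mul_le_mul_of_nonneg_left h4 hc.le
  have h6 : c * -(ε / c * n) = -(ε * n) := by field_simp
  rw [h6] at h5
  linarith

/-- `σ = 1` corresponds to `D^{+∞}` and `σ = -1` to `D^{-∞}`. -/
theorem dimH_le_dTilde {k : ℕ} (hk : Odd k) {a : ℝ} (ha : 0 < a) (ha' : a < 1 / 2) {σ : ℝ}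
    (hσ : |σ| = 1) (h : a < 1 / 3 ∧ σ = -1 ∨ 1 / 3 < a ∧ σ = 1) :
    dimH {x ∈ Ioo (0:ℝ) 1 | derivPInf (σ • Mfun k a) x} ≤ ENNReal.ofReal (dTilde a) := by
  have hb : 0 < 1 - 2 * a := by linarith
  set κ := Real.log (1 - 2 * a) - Real.log ((1 - (1 - 2 * a)) / 2) with hκ
  have hκσ : κ = |κ| * -σ ∧ 0 < |κ| := by
    rw [hκ, show (1 - (1 - 2 * a)) / 2 = a by ring]
    rcases h with ⟨h, rfl⟩ | ⟨h, rfl⟩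
    · have := sub_pos.2 (Real.log_lt_log ha (show a < 1 - 2 * a by linarith))
      exact ⟨by rw [abs_of_pos this]; ring, abs_pos.2 this.ne'⟩
    · have := sub_neg.2 (Real.log_lt_log hb (show 1 - 2 * a < a by linarith))
      exact ⟨by rw [abs_of_neg this]; ring, abs_pos.2 this.ne⟩
  refine dimH_le_hEnt hb (by linarith) (fun x hx => hx.1) fun x hx ε hε => ?_
  have hs : 0 < |κ| * (a * (1 - 2 * a)) := mul_pos hκσ.2 (by positivity)
  filter_upwards [eventually_neg_le_tSlope ha ha' hk hx.1 σ hσ hx.2 (div_pos hε hs)] with n hn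
  rw [tSlope_eq ha ha'] at hn
  have h5 := mul_le_mul_of_nonneg_left hn hs.le
  have h6 : |κ| * (a * (1 - 2 * a)) * -(ε / (|κ| * (a * (1 - 2 * a))) * n) = -(ε * n) := by
    rw [mul_neg, ← mul_assoc, mul_div_cancel₀ _ hs.ne']
  have h7 : |κ| * (a * (1 - 2 * a)) * (σ * ((n * (1 - 2 * a) - lCount x n) / (a * (1 - 2 * a)))) =
      κ * (lCount x n - (1 - 2 * a) * n) := by
    rw [hκσ.1, abs_mul, abs_abs, abs_neg, hσ]
    have := mul_div_cancel₀ ((n:ℝ) * (1 - 2 * a) - lCount x n) (show a * (1 - 2 * a) ≠ 0 by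
      positivity)
    linear_combination |κ| * σ * this
  rwa [h6, h7] at h5

/-! ### Lower bounds for the dimension -/

theorem card_words_eq (m j : ℕ) :
    Fintype.card {w : Fin m → Fin 3 // (Finset.univ.filter (fun i => w i = 1)).card = j} =
      2 ^ (m - j) * m.choose j := by
  have h : ∑ w : Fin m → Fin 3, ∏ i, (if w i = 1 then Polynomial.X else 1 : Polynomial ℕ) =
      (Polynomial.X + Polynomial.C 2) ^ m := by
    rw [← Fintype.sum_pow (fun d : Fin 3 => (if d = 1 then Polynomial.X else 1 : Polynomial ℕ)) m,
      Fin.sum_univ_three]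
    congr 1
    simp only [show ((0 : Fin 3) = 1) = False by simp, show ((2 : Fin 3) = 1) = False by simp,
      if_true, if_false, Polynomial.C_ofNat]
    ring
  have h2 := congrArg (fun p => Polynomial.coeff p j) h
  simp only [Finset.prod_ite, Finset.prod_const, one_pow, mul_one, Polynomial.finsetSum_coeff,
    Polynomial.coeff_X_pow, Polynomial.coeff_X_add_C_pow] at h2
  rw [Fintype.card_subtype, Finset.card_filter, ← Nat.cast_id (m.choose j), ← h2]
  exact Finset.sum_congr rfl fun w _ => by simp only [eq_comm]

theorem ofDigits_three_succ (δ : ℕ → Fin 3) :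
    Real.ofDigits δ = ((δ 0 : ℕ) + Real.ofDigits fun i => δ (i + 1)) / 3 := by
  rw [Real.ofDigits_eq_sum_add_ofDigits δ 1]
  simp [Real.ofDigitsTerm]
  ring

theorem ofDigits_three_lt_one {δ : ℕ → Fin 3} {n : ℕ} (h : δ n ≠ 2) : Real.ofDigits δ < 1 := by
  induction n generalizing δ with
  | zero =>
    have h1 : (δ 0 : ℕ) ≤ 1 := by
      have := (δ 0).isLt
      have : (δ 0 : ℕ) ≠ 2 := fun h' => h (Fin.ext h')
      lia
    have h2 : ((δ 0 : ℕ) : ℝ) ≤ 1 := by exact_mod_cast h1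
    rw [ofDigits_three_succ]
    linarith [Real.ofDigits_le_one fun i => δ (i + 1)]
  | succ n ih =>
    have h1 : (δ 0 : ℕ) ≤ 2 := by have := (δ 0).isLt; lia
    have h2 : ((δ 0 : ℕ) : ℝ) ≤ 2 := by exact_mod_cast h1
    rw [ofDigits_three_succ]
    linarith [ih (δ := fun i => δ (i + 1)) h]

theorem tDigit_ofDigits {δ : ℕ → Fin 3} (h : ∀ n, ∃ i, δ (n + i) ≠ 2) (i : ℕ) :
    tDigit (Real.ofDigits δ) i = δ i := by
  induction i generalizing δ with
  | zero =>
    obtain ⟨i, hi⟩ := h 1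
    rw [ofDigits_three_succ, tDigit_digit_add_zero (by have := (δ 0).isLt; lia)
      ⟨Real.ofDigits_nonneg _, ofDigits_three_lt_one (n := i) (by rwa [add_comm] at hi)⟩]
  | succ n ih =>
    obtain ⟨i, hi⟩ := h 1
    rw [ofDigits_three_succ, tDigit_digit_add_succ (by have := (δ 0).isLt; lia)
      ⟨Real.ofDigits_nonneg _, ofDigits_three_lt_one (n := i) (by rwa [add_comm] at hi)⟩, ih]
    intro k
    obtain ⟨i, hi⟩ := h (k + 1)
    exact ⟨i, by rwa [add_right_comm] at hi⟩

theorem lCount_add (x : ℝ) (n m : ℕ) :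
    lCount x (n + m) = lCount x n +
      (Finset.univ.filter (fun r : Fin m => tDigit x (n + r) = 1)).card := by
  rw [lCount, lCount, Finset.card_filter, Finset.card_filter, Finset.card_filter,
    Finset.sum_range_add, Finset.sum_range (fun r => if tDigit x (n + r) = 1 then 1 else 0)]

theorem lCount_mono (x : ℝ) : Monotone (lCount x) := fun n n' h => by
  obtain ⟨d, rfl⟩ := Nat.exists_eq_add_of_le h
  exact lCount_add x n d ▸ Nat.le_add_right _ _

/-- The points for which every ternary digit block of length `m` contains exactly `j` ones. -/
def blockSet (m j : ℕ) : Set ℝ :=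
  {x ∈ Ico (0:ℝ) 1 | ∀ i, lCount x (m * i + m) = lCount x (m * i) + j}

theorem blockSet_lCount_mul {m j : ℕ} {x : ℝ} (hx : x ∈ blockSet m j) (i : ℕ) :
    lCount x (m * i) = j * i := by
  induction i with
  | zero => simp [lCount]
  | succ i ih => rw [mul_add, mul_one, hx.2 i, ih, mul_add, mul_one]

theorem blockSet_exists_one {m j : ℕ} (hj : 0 < j) (hjm : j < m) {x : ℝ} (hx : x ∈ blockSet m j)
    (n : ℕ) : ∃ i < 2 * m, tDigit x (n + (i + 1)) = 1 := by
  have h := hx.2 ((n + 1) / m + 1)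
  rw [lCount_add] at h
  have h' : 0 < (Finset.univ.filter
    (fun r : Fin m => tDigit x (m * ((n + 1) / m + 1) + r) = 1)).card := by lia
  obtain ⟨r, hr⟩ := Finset.card_pos.1 h'
  have h1 := Nat.div_add_mod (n + 1) m
  have h2 := Nat.mod_lt (n + 1) (show 0 < m by lia)
  have h3 := r.isLt
  refine ⟨m * ((n + 1) / m + 1) + r - (n + 1), ?_, ?_⟩
  · rw [mul_add]
    lia
  · have h4 : m * ((n + 1) / m + 1) + r - (n + 1) + (n + 1) = m * ((n + 1) / m + 1) + r := by
      rw [mul_add]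
      lia
    rw [← add_assoc, add_comm n, add_assoc, h4]
    exact (Finset.mem_filter.1 hr).2

theorem blockSet_abs_lCount_sub_le {m j : ℕ} (hjm : j < m) {x : ℝ} (hx : x ∈ blockSet m j)
    (n : ℕ) : |(lCount x n : ℝ) - j / m * n| ≤ m := by
  have hm : (0:ℝ) < m := by exact_mod_cast (show 0 < m by lia)
  have hjm' : (j:ℝ) ≤ m := by exact_mod_cast hjm.le
  have h1 := Nat.div_add_mod n m
  have h2 := Nat.mod_lt n (show 0 < m by lia)
  have h3 : j * (n / m) ≤ lCount x n := by
    rw [← blockSet_lCount_mul hx]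
    exact lCount_mono x (by lia)
  have h4 : lCount x n ≤ j * (n / m + 1) := by
    rw [← blockSet_lCount_mul hx]
    exact lCount_mono x (by rw [mul_add]; lia)
  have h3' : (j : ℝ) * (n / m : ℕ) ≤ lCount x n := by exact_mod_cast h3
  have h4' : (lCount x n : ℝ) ≤ j * ((n / m : ℕ) + 1) := by exact_mod_cast h4
  have h1' : (m : ℝ) * (n / m : ℕ) + (n % m : ℕ) = n := by exact_mod_cast h1
  have h2' : ((n % m : ℕ) : ℝ) ≤ m := by exact_mod_cast h2.le
  have h5 : (j:ℝ) / m * n = j * (n / m : ℕ) + j / m * (n % m : ℕ) := by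
    rw [← h1']
    field_simp
  have h6 : 0 ≤ (j:ℝ) / m * (n % m : ℕ) := by positivity
  have h7 : (j:ℝ) / m * (n % m : ℕ) ≤ j / m * m := by gcongr
  rw [div_mul_cancel₀ _ hm.ne'] at h7
  rw [abs_le]
  constructor <;> linarith

theorem blockSet_gap {m j : ℕ} (hj : 0 < j) (hjm : j < m) {x y : ℝ} (hx : x ∈ blockSet m j)
    (hy : y ∈ blockSet m j) {t : ℕ} (h : tDigit x t ≠ tDigit y t)
    (ht : ∀ i < t, tDigit x i = tDigit y i) : (1 / 3 : ℝ) ^ (t + 2 * m + 1) ≤ |x - y| := by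
  have h1 := eq_floor_add_tShift x t
  have h2 := eq_floor_add_tShift y t
  have h3 : x - y = (tShift x t - tShift y t) * (1 / 3) ^ t := by
    rw [floor_three_pow_eq hx.1 hy.1 ht] at h1
    rw [one_div_pow]
    linear_combination h1 - h2
  obtain ⟨i, hi, hd⟩ := blockSet_exists_one hj hjm hx t
  rw [← tDigit_tShift hx.1] at hd
  have h0 := Okamoto_gap (a := 1 / 3) (ρ := 1 / 3) (by norm_num) (by norm_num) (by norm_num) le_rfl
    (by norm_num) (tShift_mem x t) (tShift_mem y t) hd
  rw [Okamoto_third (tShift_mem x t), Okamoto_third (tShift_mem y t), tDigit_tShift hx.1,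
    tDigit_tShift hy.1, add_zero] at h0
  have h4 : (1 / 3 : ℝ) ^ (i + 2) ≤ |tShift x t - tShift y t| := by
    rcases h.lt_or_gt with h | h
    · rw [abs_sub_comm]
      exact (h0.1 h).trans (le_abs_self _)
    · exact (h0.2 h).trans (le_abs_self _)
  rw [h3, abs_mul, abs_of_pos (a := (1 / 3 : ℝ) ^ t) (by positivity)]
  calc (1 / 3 : ℝ) ^ (t + 2 * m + 1) ≤ (1 / 3) ^ (i + 2 + t) :=
        pow_le_pow_of_le_one (by norm_num) (by norm_num) (by lia)
    _ = (1 / 3) ^ (i + 2) * (1 / 3) ^ t := pow_add _ _ _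
    _ ≤ _ := by gcongr

theorem le_dimH_blockSet {m j : ℕ} (hj : 0 < j) (hjm : j < m) :
    ENNReal.ofReal (Real.log ((2 ^ (m - j) * m.choose j : ℕ) : ℝ) / (m * Real.log 3)) ≤
      dimH (blockSet m j) := by
  let W := {w : Fin m → Fin 3 // (Finset.univ.filter (fun i => w i = 1)).card = j}
  have hm : 0 < m := by lia
  set N := Fintype.card W with hN
  have hN' : 2 ^ (m - j) * m.choose j = N := (card_words_eq m j).symm
  have hN2 : 1 < N := by
    rw [← hN']
    calc 1 < 2 ^ (m - j) := Nat.one_lt_two_pow (by lia)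
      _ ≤ _ := Nat.le_mul_of_pos_right _ (Nat.choose_pos hjm.le)
  rw [hN']
  let e : Fin N ≃ W := (Fintype.equivFin W).symm
  let δ : (ℕ → Fin N) → ℕ → Fin 3 := fun ω i => (e (ω (i / m))).1 ⟨i % m, Nat.mod_lt i hm⟩
  have hδ : ∀ ω i (r : Fin m), δ ω (m * i + r) = (e (ω i)).1 r := by
    intro ω i r
    have h1 : (m * i + r) / m = i := by
      rw [Nat.mul_add_div hm, Nat.div_eq_of_lt r.isLt, add_zero]
    have h2 : (m * i + r) % m = r := by rw [Nat.mul_add_mod, Nat.mod_eq_of_lt r.isLt]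
    simp only [δ, h1, h2, Fin.eta]
  have hδ2 : ∀ ω n, ∃ i, δ ω (n + i) ≠ 2 := by
    intro ω n
    have h := (e (ω n)).2
    obtain ⟨r, hr⟩ := Finset.card_pos.1 (h ▸ hj)
    have hn : n ≤ m * n := Nat.le_mul_of_pos_left n hm
    refine ⟨m * n - n + r, ?_⟩
    rw [show n + (m * n - n + r) = m * n + r by lia, hδ, (Finset.mem_filter.1 hr).2]
    decide
  let X : (ℕ → Fin N) → ℝ := fun ω => Real.ofDigits (δ ω)
  have hXd : ∀ ω i, tDigit (X ω) i = δ ω i := fun ω i => tDigit_ofDigits (hδ2 ω) i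
  have hXE : ∀ ω, X ω ∈ blockSet m j := by
    intro ω
    refine ⟨⟨Real.ofDigits_nonneg _, (hδ2 ω 0).elim fun _ h => ofDigits_three_lt_one h⟩,
      fun i => ?_⟩
    rw [lCount_add]
    congr 1
    simp only [hXd, hδ]
    refine Eq.trans ?_ (e (ω i)).2
    congr! 2 with r
    exact ⟨fun h => Fin.ext h, fun h => by rw [h]; rfl⟩
  have hR : (1:ℝ) < N := by exact_mod_cast hN2
  have hmR : (0:ℝ) < m := by exact_mod_cast hm
  set s : ℝ := Real.log N / (m * Real.log 3) with hs
  have hs0 : 0 < s := div_pos (Real.log_pos hR) (mul_pos hmR log_three_pos)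
  have hpow : ∀ i : ℕ, ((1 / 3 : ℝ) ^ (m * i)) ^ s = (1 / N) ^ i := by
    intro i
    rw [one_div, one_div, inv_pow, inv_pow, Real.inv_rpow (by positivity), ← Real.rpow_natCast,
      ← Real.rpow_mul (by norm_num)]
    congr 1
    rw [Real.rpow_def_of_pos (by norm_num), ← Real.rpow_natCast,
      Real.rpow_def_of_pos (by linarith), hs]
    congr 1
    push_cast
    field_simp [log_three_pos.ne']
  have key : ∀ ω ω', ω ≠ ω' → 0 < |X ω - X ω'| ∧
      |Real.ofDigits ω - Real.ofDigits ω'| ≤ (N:ℝ) ^ 4 * |X ω - X ω'| ^ s := by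
    classical
    intro ω ω' hne
    have hex := Function.ne_iff.1 hne
    set i := Nat.find hex with hi
    have hi1 : ω i ≠ ω' i := Nat.find_spec hex
    have hi2 : ∀ k < i, ω k = ω' k := fun k hk => not_not.1 (Nat.find_min hex hk)
    have hne' : (e (ω i)).1 ≠ (e (ω' i)).1 := fun h => hi1 (e.injective (Subtype.ext h))
    obtain ⟨r, hr⟩ := Function.ne_iff.1 hne'
    have hdig : tDigit (X ω) (m * i + r) ≠ tDigit (X ω') (m * i + r) := by
      rw [hXd, hXd, hδ, hδ]
      exact fun h => hr (Fin.ext h)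
    have hext : ∃ t, tDigit (X ω) t ≠ tDigit (X ω') t := ⟨_, hdig⟩
    have ht := Nat.find_min' hext hdig
    have hgap := blockSet_gap hj hjm (hXE ω) (hXE ω') (Nat.find_spec hext)
      fun k hk => not_not.1 (Nat.find_min hext hk)
    have hgap' : (1 / 3 : ℝ) ^ (m * (i + 4)) ≤ |X ω - X ω'| := by
      refine le_trans (pow_le_pow_of_le_one (by norm_num) (by norm_num) ?_) hgap
      have := r.isLt
      rw [mul_add]
      lia
    refine ⟨lt_of_lt_of_le (by positivity) hgap', ?_⟩
    calc |Real.ofDigits ω - Real.ofDigits ω'| ≤ ((N:ℝ) ^ i)⁻¹ :=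
          Real.abs_ofDigits_sub_ofDigits_le hi2
      _ = (N:ℝ) ^ 4 * (1 / N) ^ (i + 4) := by
          rw [one_div, inv_pow, pow_add]
          field_simp
      _ = (N:ℝ) ^ 4 * ((1 / 3 : ℝ) ^ (m * (i + 4))) ^ s := by rw [hpow]
      _ ≤ _ := by gcongr
  have hinj : Function.Injective X := fun ω ω' h => by
    by_contra hne
    have := (key ω ω' hne).1
    rw [h, sub_self, abs_zero] at this
    exact this.false
  have : Nonempty (ℕ → Fin N) := ⟨fun _ => ⟨0, by lia⟩⟩
  have hinv := Function.leftInverse_invFun hinj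
  let g : ℝ → ℝ := fun x => Real.ofDigits (Function.invFun X x)
  have hholder : HolderOnWith ((N : NNReal) ^ 4) s.toNNReal g (range X) := by
    rintro _ ⟨ω, rfl⟩ _ ⟨ω', rfl⟩
    simp only [g, hinv ω, hinv ω']
    by_cases hne : ω = ω'
    · simp [hne]
    obtain ⟨h1, h2⟩ := key ω ω' hne
    rw [edist_dist, edist_dist, Real.dist_eq, Real.dist_eq, Real.coe_toNNReal _ hs0.le,
      ENNReal.ofReal_rpow_of_pos h1]
    refine (ENNReal.ofReal_le_ofReal h2).trans ?_
    rw [ENNReal.ofReal_mul (by positivity), ENNReal.ofReal_pow (by positivity),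
      ENNReal.ofReal_natCast]
    simp
  have hdim := hholder.dimH_image_le (Real.toNNReal_pos.2 hs0)
  have hsub : Icc (0:ℝ) 1 ⊆ g '' range X := by
    intro y hy
    obtain ⟨ω, -, hω⟩ := Real.ofDigits_SurjOn hN2 hy
    exact ⟨X ω, ⟨ω, rfl⟩, by simp only [g, hinv ω, hω]⟩
  have h1 : (1:ℝ≥0∞) ≤ dimH (range X) / s.toNNReal := by
    refine le_trans ?_ ((dimH_mono hsub).trans hdim)
    rw [Real.dimH_of_nonempty_interior (by rw [interior_Icc]; exact ⟨1 / 2, by norm_num⟩)]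
    simp
  have hs1 : ((s.toNNReal : NNReal) : ℝ≥0∞) ≠ 0 := by
    simpa using hs0
  rw [ENNReal.le_div_iff_mul_le (Or.inl hs1) (Or.inl ENNReal.coe_ne_top), one_mul] at h1
  exact h1.trans (dimH_mono (range_subset_iff.2 hXE))

theorem factorial_mul_pow_le (i j : ℕ) : j.factorial * j ^ i ≤ i.factorial * j ^ j := by
  rcases le_total i j with h | h
  · rw [← Nat.factorial_mul_descFactorial (Nat.sub_le j i), Nat.sub_sub_self h]
    calc i.factorial * j.descFactorial (j - i) * j ^ i
        ≤ i.factorial * j ^ (j - i) * j ^ i := by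
          gcongr
          exact Nat.descFactorial_le_pow j (j - i)
      _ = i.factorial * j ^ j := by rw [mul_assoc, ← pow_add, Nat.sub_add_cancel h]
  · calc j.factorial * j ^ i = j.factorial * j ^ (i - j) * j ^ j := by
          rw [mul_assoc, ← pow_add, Nat.sub_add_cancel h]
      _ ≤ _ := by
          gcongr
          exact Nat.factorial_mul_pow_sub_le_factorial h

/-- The largest term of the binomial expansion of `(j + (m - j)) ^ m` is the one of index `j`. -/
theorem pow_self_le_choose_mul {m j : ℕ} (hjm : j ≤ m) :
    m ^ m ≤ (m + 1) * (j ^ j * (m - j) ^ (m - j) * m.choose j) := by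
  nth_rewrite 1 [← Nat.add_sub_cancel' hjm]
  rw [add_pow]
  refine (Finset.sum_le_card_nsmul _ _ (j ^ j * (m - j) ^ (m - j) * m.choose j)
    fun i hi => ?_).trans_eq (by rw [Finset.card_range, smul_eq_mul])
  have hi' : i ≤ m := by
    have := Finset.mem_range.1 hi
    lia
  have h1 := Nat.mul_le_mul (factorial_mul_pow_le i j) (factorial_mul_pow_le (m - i) (m - j))
  have h2 := Nat.choose_mul_factorial_mul_factorial hi'
  have h3 := Nat.choose_mul_factorial_mul_factorial hjm
  have hpos : 0 < i.factorial * (m - i).factorial * (j.factorial * (m - j).factorial) := by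
    positivity
  refine le_of_mul_le_mul_right ?_ hpos
  calc j ^ i * (m - j) ^ (m - i) * m.choose i *
        (i.factorial * (m - i).factorial * (j.factorial * (m - j).factorial))
      = m.choose i * i.factorial * (m - i).factorial *
        (j.factorial * j ^ i * ((m - j).factorial * (m - j) ^ (m - i))) := by ring
    _ ≤ m.choose i * i.factorial * (m - i).factorial *
        (i.factorial * j ^ j * ((m - i).factorial * (m - j) ^ (m - j))) := by gcongr
    _ = m.choose j * j.factorial * (m - j).factorial *
        (i.factorial * j ^ j * ((m - i).factorial * (m - j) ^ (m - j))) := by rw [h2, h3]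
    _ = _ := by ring

theorem hEnt_le_log_card {m j : ℕ} (hj : 0 < j) (hjm : j < m) :
    hEnt (j / m) - Real.log (m + 1) / (m * Real.log 3) ≤
      Real.log ((2 ^ (m - j) * m.choose j : ℕ) : ℝ) / (m * Real.log 3) := by
  have hm : (0:ℝ) < m := by exact_mod_cast (show 0 < m by lia)
  have hjR : (0:ℝ) < j := by exact_mod_cast hj
  have hjmR : (0:ℝ) < m - j := sub_pos.2 (by exact_mod_cast hjm)
  have hC : (0:ℝ) < m.choose j := by exact_mod_cast Nat.choose_pos hjm.le
  have h : ((m ^ m : ℕ) : ℝ) ≤ ((m + 1) * (j ^ j * (m - j) ^ (m - j) * m.choose j) : ℕ) := by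
    exact_mod_cast pow_self_le_choose_mul hjm.le
  push_cast [Nat.cast_sub hjm.le] at h
  have h1 := Real.log_le_log (by positivity) h
  rw [Real.log_mul (by positivity) (by positivity), Real.log_mul (by positivity) (by positivity),
    Real.log_mul (by positivity) (by positivity), Real.log_pow, Real.log_pow, Real.log_pow,
    Nat.cast_sub hjm.le] at h1
  have hent : hEnt (j / m) * (m * Real.log 3) = m * Real.log m - j * Real.log j -
      (m - j) * Real.log (m - j) + (m - j) * Real.log 2 := by
    rw [hEnt, show (1:ℝ) - j / m = (m - j) / m by field_simp, Real.log_div hjR.ne' hm.ne',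
      Real.log_div hjmR.ne' hm.ne']
    have := log_three_pos.ne'
    field_simp
    ring
  have hs := mul_pos hm log_three_pos
  rw [le_div_iff₀ hs, sub_mul, hent, div_mul_cancel₀ _ hs.ne']
  push_cast
  rw [Real.log_mul (by positivity) (by positivity), Real.log_pow, Nat.cast_sub hjm.le]
  linarith

theorem hEnt_le_dimH_of_blockSet_subset {m j : ℕ} (hj : 0 < j) (hjm : j < m) {D : Set ℝ}
    (hD : ∀ q : ℕ, 0 < q → blockSet (q * m) (q * j) ⊆ D) :
    ENNReal.ofReal (hEnt (j / m)) ≤ dimH D := by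
  have hm : (0:ℝ) < m := by exact_mod_cast (show 0 < m by lia)
  have hlim : Tendsto (fun q : ℕ => hEnt (j / m) -
      Real.log ((q * m : ℕ) + 1) / ((q * m : ℕ) * Real.log 3)) atTop (𝓝 (hEnt (j / m) - 0)) := by
    refine tendsto_const_nhds.sub ?_
    have h1 : Tendsto (fun x : ℝ => Real.log (x + 1) / x) atTop (𝓝 0) := by
      have h2 : Tendsto (fun x : ℝ => Real.log (x + 1) / (1 * (x + 1) + -1)) atTop (𝓝 0) := by
        have := (Real.tendsto_pow_log_div_mul_add_atTop 1 (-1) 1 one_ne_zero).comp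
          (tendsto_atTop_add_const_right atTop (1:ℝ) tendsto_id)
        simpa [Function.comp_def] using this
      simpa using h2
    have h3 : Tendsto (fun q : ℕ => ((q * m : ℕ) : ℝ)) atTop atTop :=
      tendsto_natCast_atTop_atTop.comp (tendsto_id.atTop_mul_const' (show 0 < m by lia))
    have h4 := (h1.comp h3).div_const (Real.log 3)
    rw [zero_div] at h4
    exact h4.congr fun q => by rw [Function.comp, div_div]
  rw [sub_zero] at hlim
  refine le_of_tendsto (ENNReal.tendsto_ofReal hlim) ?_
  filter_upwards [eventually_ge_atTop 1] with q hq
  have hqR : (q:ℝ) ≠ 0 := by exact_mod_cast (show q ≠ 0 by lia)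
  have h1 : (j : ℝ) / m = (q * j : ℕ) / (q * m : ℕ) := by
    push_cast
    rw [mul_div_mul_left _ _ hqR]
  have hj' : 0 < q * j := by positivity
  have hjm' : q * j < q * m := Nat.mul_lt_mul_of_pos_left hjm (by lia)
  rw [h1]
  exact (ENNReal.ofReal_le_ofReal (hEnt_le_log_card hj' hjm')).trans
    ((le_dimH_blockSet hj' hjm').trans (dimH_mono (hD q hq)))

theorem hEnt_le_dimH_of_Ioo {p q : ℝ} (hp : 0 ≤ p) (hpq : p < q) (hq : q ≤ 1) {D : Set ℝ}
    (hD : ∀ m j : ℕ, 0 < j → j < m → (j / m : ℝ) ∈ Ioo p q → blockSet m j ⊆ D) :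
    ∀ r ∈ Icc p q, ENNReal.ofReal (hEnt r) ≤ dimH D := by
  have hcl : IsClosed {r : ℝ | ENNReal.ofReal (hEnt r) ≤ dimH D} :=
    isClosed_le (ENNReal.continuous_ofReal.comp continuous_hEnt) continuous_const
  have hrat : Ioo p q ∩ range ((↑) : ℚ → ℝ) ⊆ {r : ℝ | ENNReal.ofReal (hEnt r) ≤ dimH D} := by
    rintro _ ⟨hr, r, rfl⟩
    have hr0 : 0 < r := by exact_mod_cast hp.trans_lt hr.1
    have hr1 : r < 1 := by exact_mod_cast hr.2.trans_le hq
    have hnum : 0 < r.num := Rat.num_pos.2 hr0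
    obtain ⟨j, hj⟩ := Int.eq_ofNat_of_zero_le hnum.le
    have hjr : ((j : ℝ) / r.den) = r := by
      rw [Rat.cast_def, hj]
      simp
    have hj0 : 0 < j := by lia
    have hden : (0:ℝ) < r.den := by exact_mod_cast r.den_pos
    have hjm : j < r.den := by
      have : (r:ℝ) < 1 := by exact_mod_cast hr1
      rw [← hjr, div_lt_one hden] at this
      exact_mod_cast this
    rw [mem_ofPred_eq, ← hjr]
    refine hEnt_le_dimH_of_blockSet_subset hj0 hjm fun s hs => hD _ _ (by positivity)
      (Nat.mul_lt_mul_of_pos_left hjm hs) ?_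
    push_cast
    rw [mul_div_mul_left _ _ (by exact_mod_cast hs.ne'), hjr]
    exact hr
  rw [← closure_Ioo hpq.ne]
  refine closure_minimal ?_ hcl
  exact (Rat.denseRange_cast.open_subset_closure_inter isOpen_Ioo).trans
    (closure_minimal hrat hcl)

theorem tendsto_lCount_div {m j : ℕ} (hjm : j < m) {x : ℝ} (hx : x ∈ blockSet m j) :
    Tendsto (fun n : ℕ => (lCount x n : ℝ) / n) atTop (𝓝 (j / m)) := by
  rw [tendsto_iff_dist_tendsto_zero]
  refine squeeze_zero' (Eventually.of_forall fun _ => dist_nonneg) ?_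
    (tendsto_const_div_atTop_nhds_zero_nat (m : ℝ))
  filter_upwards [eventually_gt_atTop 0] with n hn
  have hn' : (0:ℝ) < n := by exact_mod_cast hn
  rw [Real.dist_eq, show (lCount x n : ℝ) / n - j / m = (lCount x n - j / m * n) / n by
    field_simp, abs_div, abs_of_pos hn']
  gcongr
  exact blockSet_abs_lCount_sub_le hjm hx n

theorem tendsto_quotient_of_mem_blockSet {a : ℝ} (ha : 0 < a) (ha' : a < 1 / 2) {k : ℕ}
    (hk : 1 ≤ k) {m j : ℕ} (hj : 0 < j) (hjm : j < m)
    (hφ : 0 ≤ (phiOk a - j / m) * (Real.log a - Real.log (1 - 2 * a))) {σ : ℝ} (hσ : |σ| = 1)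
    (hD : 0 < σ * (1 - 2 * a - j / m) ^ k) {x : ℝ} (hx : x ∈ blockSet m j) :
    Tendsto (fun y => σ * ((Mfun k a y - Mfun k a x) / (y - x))) (𝓝[Icc 0 1 \ {x}] x) atTop := by
  have hb : 0 < 1 - 2 * a := by linarith
  have hB : 0 < a * (1 - 2 * a) := by positivity
  set p : ℝ := j / m with hp
  have hθ : 0 < σ * ((1 - 2 * a - p) / (a * (1 - 2 * a))) ^ k := by
    rw [div_pow, ← mul_div_assoc]
    positivity
  refine tendsto_quotient_of_bounded_runs ha ha' hk hx.1 (J := 2 * m)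
    (blockSet_exists_one hj hjm hx)
    (c := Real.exp (-(m * |Real.log (1 - 2 * a) - Real.log a|))) (Real.exp_pos _)
    (half_pos hθ) hσ (fun n => ?_) ?_
  · have hW := tWeight_pos ha ha' x n
    rw [← Real.le_log_iff_exp_le (by positivity), Real.log_mul (by positivity) hW.ne',
      Real.log_pow, log_tWeight ha ha']
    have h2 := phiOk_mul ha ha'
    rw [Real.log_mul (by norm_num) ha.ne'] at h2
    have h3 : (n:ℝ) * (phiOk a * (Real.log a - Real.log (1 - 2 * a))) =
      n * (Real.log 3 + Real.log a) := by rw [h2]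
    have h4 : 0 ≤ (n:ℝ) * ((phiOk a - p) * (Real.log a - Real.log (1 - 2 * a))) := by positivity
    have h5 := neg_abs_le ((lCount x n - p * n) * (Real.log (1 - 2 * a) - Real.log a))
    have h6 : |(lCount x n - p * n) * (Real.log (1 - 2 * a) - Real.log a)| ≤
        m * |Real.log (1 - 2 * a) - Real.log a| := by
      rw [abs_mul]
      gcongr
      exact blockSet_abs_lCount_sub_le hjm hx n
    linarith
  · have h1 : Tendsto (fun n : ℕ => σ * ((1 - 2 * a - lCount x n / n) / (a * (1 - 2 * a))) ^ k)
        atTop (𝓝 (σ * ((1 - 2 * a - p) / (a * (1 - 2 * a))) ^ k)) :=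
      (((tendsto_const_nhds.sub (tendsto_lCount_div hjm hx)).div_const _).pow k).const_mul σ
    filter_upwards [h1.eventually_const_le (half_lt_self hθ), eventually_gt_atTop 0] with n hn hn0
    have hn' : (0:ℝ) < n := by exact_mod_cast hn0
    have h2 : tSlope a x n = n * ((1 - 2 * a - lCount x n / n) / (a * (1 - 2 * a))) := by
      rw [tSlope_eq ha ha', ← mul_div_assoc, mul_sub (n:ℝ) (1 - 2 * a), mul_div_cancel₀ _ hn'.ne']
    rw [h2, mul_pow, mul_left_comm, mul_comm]
    gcongr

theorem blockSet_subset_Ioo {m j : ℕ} (hj : 0 < j) (hjm : j < m) : blockSet m j ⊆ Ioo 0 1 := by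
  refine fun x hx => ⟨hx.1.1.lt_of_ne' fun h0 => ?_, hx.1.2⟩
  obtain ⟨i, -, hi⟩ := blockSet_exists_one hj hjm hx 0
  rw [h0] at hi
  simp [tDigit] at hi

theorem blockSet_subset_DPlus {a : ℝ} (ha : 0 < a) (ha' : a < 1 / 2) {k : ℕ}
    (hk : 1 ≤ k) {m j : ℕ} (hj : 0 < j) (hjm : j < m)
    (hφ : 0 ≤ (phiOk a - j / m) * (Real.log a - Real.log (1 - 2 * a)))
    (hD : 0 < (1 - 2 * a - j / m : ℝ) ^ k) : blockSet m j ⊆ DPlus k a := by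
  refine fun x hx => ⟨blockSet_subset_Ioo hj hjm hx, ?_⟩
  have := tendsto_quotient_of_mem_blockSet ha ha' hk hj hjm hφ (σ := 1) (by simp) (by simpa) hx
  simpa [derivPInf] using this

theorem blockSet_subset_DMinus {a : ℝ} (ha : 0 < a) (ha' : a < 1 / 2) {k : ℕ}
    (hk : 1 ≤ k) {m j : ℕ} (hj : 0 < j) (hjm : j < m)
    (hφ : 0 ≤ (phiOk a - j / m) * (Real.log a - Real.log (1 - 2 * a)))
    (hD : (1 - 2 * a - j / m : ℝ) ^ k < 0) : blockSet m j ⊆ DMinus k a := by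
  refine fun x hx => ⟨blockSet_subset_Ioo hj hjm hx, ?_⟩
  have := tendsto_quotient_of_mem_blockSet ha ha' hk hj hjm hφ (σ := -1) (by simp) (by simpa) hx
  rw [derivMInf, ← tendsto_neg_atTop_iff]
  simpa using this

theorem hEnt_le_dimH_DPlus_of_lt {a : ℝ} (ha : 0 < a) (h : a < 1 / 3) {k : ℕ} (hk : 1 ≤ k) :
    ENNReal.ofReal (dOk a) ≤ dimH (DPlus k a) := by
  obtain ⟨h1, h2⟩ := phiOk_mem_of_lt ha h
  have hlog := Real.log_lt_log ha (show a < 1 - 2 * a by linarith)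
  exact hEnt_le_dimH_of_Ioo (by linarith) h2 (by linarith) (fun m j hj hjm hp =>
    blockSet_subset_DPlus ha (by linarith) hk hj hjm
      (mul_nonneg_of_nonpos_of_nonpos (by linarith [hp.1]) (by linarith))
      (pow_pos (by linarith [hp.2]) k)) _ ⟨le_rfl, h2.le⟩

theorem hEnt_le_dimH_DPlus_of_gt_of_even {a : ℝ} (ha' : a < 1 / 2) (h : 1 / 3 < a) {k : ℕ}
    (hk : 1 ≤ k) (hk2 : Even k) : ENNReal.ofReal (dOk a) ≤ dimH (DPlus k a) := by
  obtain ⟨h1, h2⟩ := phiOk_mem_of_gt ha' h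
  have hlog := Real.log_lt_log (by linarith) (show 1 - 2 * a < a by linarith)
  exact hEnt_le_dimH_of_Ioo (by linarith) h1 (by linarith) (fun m j hj hjm hp =>
    blockSet_subset_DPlus (by linarith) ha' hk hj hjm
      (mul_nonneg (by linarith [hp.2]) (by linarith))
      (hk2.pow_pos (by linarith [hp.1]))) _ ⟨h1.le, le_rfl⟩

theorem hEnt_le_dimH_DMinus_of_gt {a : ℝ} (ha' : a < 1 / 2) (h : 1 / 3 < a) {k : ℕ}
    (hk : 1 ≤ k) (hk2 : Odd k) : ENNReal.ofReal (dOk a) ≤ dimH (DMinus k a) := by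
  obtain ⟨h1, h2⟩ := phiOk_mem_of_gt ha' h
  have hlog := Real.log_lt_log (by linarith) (show 1 - 2 * a < a by linarith)
  exact hEnt_le_dimH_of_Ioo (by linarith) h1 (by linarith) (fun m j hj hjm hp =>
    blockSet_subset_DMinus (by linarith) ha' hk hj hjm
      (mul_nonneg (by linarith [hp.2]) (by linarith))
      (hk2.pow_neg (by linarith [hp.1]))) _ ⟨h1.le, le_rfl⟩

theorem hEnt_le_dimH_DPlus_of_ge {a : ℝ} (ha' : a < 1 / 2) (h : 1 / 3 ≤ a) {k : ℕ}
    (hk : 1 ≤ k) : ENNReal.ofReal (dTilde a) ≤ dimH (DPlus k a) := by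
  have h1 : 1 - 2 * a ≤ phiOk a := by
    rcases h.eq_or_lt with rfl | h
    · norm_num [phiOk_third]
    · exact (phiOk_mem_of_gt ha' h).1.le
  have hlog := Real.log_le_log (by linarith) (show 1 - 2 * a ≤ a by linarith)
  exact hEnt_le_dimH_of_Ioo le_rfl (show 0 < 1 - 2 * a by linarith) (by linarith)
    (fun m j hj hjm hp => blockSet_subset_DPlus (by linarith) ha' hk hj hjm
      (mul_nonneg (by linarith [hp.2]) (by linarith))
      (pow_pos (by linarith [hp.2]) k)) _ ⟨by linarith, le_rfl⟩

theorem hEnt_le_dimH_DMinus_of_le {a : ℝ} (ha : 0 < a) (h : a ≤ 1 / 3) {k : ℕ}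
    (hk : 1 ≤ k) (hk2 : Odd k) : ENNReal.ofReal (dTilde a) ≤ dimH (DMinus k a) := by
  have h1 : phiOk a ≤ 1 - 2 * a := by
    rcases h.eq_or_lt with rfl | h
    · norm_num [phiOk_third]
    · exact (phiOk_mem_of_lt ha h).2.le
  have hlog := Real.log_le_log ha (show a ≤ 1 - 2 * a by linarith)
  exact hEnt_le_dimH_of_Ioo (by linarith) (show 1 - 2 * a < 1 by linarith) le_rfl
    (fun m j hj hjm hp => blockSet_subset_DMinus ha (by linarith) hk hj hjm
      (mul_nonneg_of_nonpos_of_nonpos (by linarith [hp.1]) (by linarith))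
      (hk2.pow_neg (by linarith [hp.1]))) _ ⟨le_rfl, by linarith⟩

theorem dTilde_third : dTilde (1 / 3) = 1 := by
  rw [dTilde, show (1 : ℝ) - 2 * (1 / 3) = 1 / 3 by norm_num, hEnt_third]

theorem dOk_third : dOk (1 / 3) = 1 := by rw [dOk, phiOk_third, hEnt_third]

theorem dimH_DPlus_le_dTilde {k : ℕ} (hk : Odd k) {a : ℝ} (ha' : a < 1 / 2) (h : 1 / 3 < a) :
    dimH (DPlus k a) ≤ ENNReal.ofReal (dTilde a) := by
  simpa only [one_smul] using! dimH_le_dTilde hk (by linarith) ha' abs_one (Or.inr ⟨h, rfl⟩)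

theorem dimH_DMinus_le_dTilde {k : ℕ} (hk : Odd k) {a : ℝ} (ha : 0 < a) (h : a < 1 / 3) :
    dimH (DMinus k a) ≤ ENNReal.ofReal (dTilde a) := by
  have h1 := dimH_le_dTilde hk ha (by linarith) (σ := -1) (by simp) (Or.inl ⟨h, rfl⟩)
  simpa only [neg_smul, one_smul, ← derivMInf_iff_neg] using! h1

/-- Hausdorff dimensions of the sets of infinite derivatives for `0 < a < 1/2`. -/
theorem stmt9 (k : ℕ) (hk : 1 ≤ k) (a : ℝ) (ha : 0 < a) (ha' : a < 1/2) :
    dimH (DPlus k a ∪ DMinus k a) = ENNReal.ofReal (dOk a) ∧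
    (Even k → dimH (DPlus k a) = ENNReal.ofReal (dOk a)) ∧
    (Odd k →
      (a < 1/3 →
        dimH (DPlus k a) = ENNReal.ofReal (dOk a) ∧
        dimH (DMinus k a) = ENNReal.ofReal (dTilde a) ∧
        dTilde a < dOk a) ∧
      (a = 1/3 →
        dimH (DPlus k a) = 1 ∧ dimH (DMinus k a) = 1) ∧
      (1/3 < a →
        dimH (DPlus k a) = ENNReal.ofReal (dTilde a) ∧
        dimH (DMinus k a) = ENNReal.ofReal (dOk a) ∧
        dTilde a < dOk a)) := by
  have hU := dimH_DPlus_union_DMinus_le (k := k) ha ha'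
  have hP := (dimH_mono (subset_union_left (s := DPlus k a) (t := DMinus k a))).trans hU
  have hM := (dimH_mono (subset_union_right (s := DPlus k a) (t := DMinus k a))).trans hU
  have hthird : a = 1 / 3 → ENNReal.ofReal (dOk a) ≤ dimH (DPlus k a) := by
    intro h
    have h1 := hEnt_le_dimH_DPlus_of_ge ha' h.ge hk
    rwa [show dTilde a = dOk a by rw [h, dTilde_third, dOk_third]] at h1
  have heven : Even k → ENNReal.ofReal (dOk a) ≤ dimH (DPlus k a) := by
    intro hk2
    rcases lt_trichotomy a (1 / 3) with h | h | h
    · exact hEnt_le_dimH_DPlus_of_lt ha h hk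
    · exact hthird h
    · exact hEnt_le_dimH_DPlus_of_gt_of_even ha' h hk hk2
  refine ⟨hU.antisymm ?_, fun hk2 => hP.antisymm (heven hk2), fun hk2 => ⟨fun h => ?_, ?_, ?_⟩⟩
  · rcases Nat.even_or_odd k with hk2 | hk2
    · exact (heven hk2).trans (dimH_mono subset_union_left)
    rcases lt_trichotomy a (1 / 3) with h | h | h
    · exact (hEnt_le_dimH_DPlus_of_lt ha h hk).trans (dimH_mono subset_union_left)
    · exact (hthird h).trans (dimH_mono subset_union_left)
    · exact (hEnt_le_dimH_DMinus_of_gt ha' h hk hk2).trans (dimH_mono subset_union_right)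
  · exact ⟨hP.antisymm (hEnt_le_dimH_DPlus_of_lt ha h hk),
      (dimH_DMinus_le_dTilde hk2 ha h).antisymm (hEnt_le_dimH_DMinus_of_le ha h.le hk hk2),
      dTilde_lt_dOk ha ha' h.ne⟩
  · rintro rfl
    have h1 := hthird rfl
    have h2 := hEnt_le_dimH_DMinus_of_le ha le_rfl hk hk2
    rw [dOk_third, ENNReal.ofReal_one] at h1 hP hM
    rw [dTilde_third, ENNReal.ofReal_one] at h2
    exact ⟨hP.antisymm h1, hM.antisymm h2⟩
  · intro h
    exact ⟨(dimH_DPlus_le_dTilde hk2 ha' h).antisymm (hEnt_le_dimH_DPlus_of_ge ha' h.le hk),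
      hM.antisymm (hEnt_le_dimH_DMinus_of_gt ha' h hk hk2), dTilde_lt_dOk ha ha' h.ne'⟩
end

section
/- Define polynomials q_k ∈ ℝ[t] by q₁(t) = t and q_{k+1}(t) = t·q_k(t) − q_k'(t) for k ≥ 1. Then for each k ∈ ℕ, q_k has exactly k distinct real zeros, the set of zeros of q_k is symmetric about 0 (i.e., t is a zero iff −t is a zero), and q_k is an even polynomial when k is even and an odd polynomial when k is odd. -/
open Filter Topology MeasureTheory Set
open scoped ENNReal

/-- The polynomials `q₁(t) = t`, `q_{k+1}(t) = t q_k(t) - q_k'(t)` (with `q₀ := 1` as a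
convention; only indices `k ≥ 1` are used). -/
noncomputable def qPoly : ℕ → Polynomial ℝ
  | 0 => 1
  | 1 => Polynomial.X
  | (k + 2) => Polynomial.X * qPoly (k + 1) - Polynomial.derivative (qPoly (k + 1))

/-- A real polynomial times the Gaussian `exp (-x ^ 2 / 2)` vanishes at infinity. -/
theorem tendsto_eval_mul_gaussian_cocompact (p : Polynomial ℝ) :
    Tendsto (fun x : ℝ => p.eval x * Real.exp (-(1 / 2) * x ^ 2)) (cocompact ℝ) (𝓝 0) := by
  induction p using Polynomial.induction_on' with
  | add p q hp hq => simpa [add_mul] using hp.add hq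
  | monomial n a =>
    have h := (tendsto_rpow_abs_mul_exp_neg_mul_sq_cocompact one_half_pos n).const_mul |a|
    rw [mul_zero] at h
    refine squeeze_zero_norm (fun x => le_of_eq ?_) h
    simp [mul_assoc]

theorem hasDerivAt_eval_mul_gaussian (p : Polynomial ℝ) (x : ℝ) :
    HasDerivAt (fun x : ℝ => p.eval x * Real.exp (-(1 / 2) * x ^ 2))
      (-((Polynomial.X * p - Polynomial.derivative p).eval x * Real.exp (-(1 / 2) * x ^ 2))) x := by
  have h : HasDerivAt (fun x : ℝ => -(1 / 2) * x ^ 2) (-x) x := by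
    refine ((hasDerivAt_pow 2 x).const_mul (-(1 / 2) : ℝ)).congr_deriv ?_
    norm_num
    ring
  refine ((p.hasDerivAt x).mul h.exp).congr_deriv ?_
  simp only [Polynomial.eval_sub, Polynomial.eval_mul, Polynomial.eval_X]
  ring

/-- The operator `p ↦ X * p - p'` increases the number of distinct real roots, by Rolle's theorem
applied to `p * exp (-x ^ 2 / 2)` on the extended real line, parametrized by `Real.tan`. -/
theorem card_roots_toFinset_lt_card_roots_X_mul_sub_derivative {p : Polynomial ℝ} (hp : p ≠ 0)
    (hq : Polynomial.X * p - Polynomial.derivative p ≠ 0) :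
    p.roots.toFinset.card <
      (Polynomial.X * p - Polynomial.derivative p).roots.toFinset.card := by
  set q := Polynomial.X * p - Polynomial.derivative p with hq_def
  set f : ℝ → ℝ := fun x => p.eval x * Real.exp (-(1 / 2) * x ^ 2)
  have hf0 : Tendsto f (cocompact ℝ) (𝓝 0) := tendsto_eval_mul_gaussian_cocompact p
  have hroot : ∀ x ∈ p.roots.toFinset.image Real.arctan,
      x ∈ Ioo (-(Real.pi / 2)) (Real.pi / 2) ∧ Tendsto (fun u => f (Real.tan u)) (𝓝 x) (𝓝 0) := by
    intro x hx
    obtain ⟨r, hr, rfl⟩ := Finset.mem_image.1 hx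
    rw [Multiset.mem_toFinset, Polynomial.mem_roots hp] at hr
    have hmem := Real.arctan_mem_Ioo r
    have ht : Tendsto Real.tan (𝓝 (Real.arctan r)) (𝓝 r) := by
      simpa using (Real.hasDerivAt_tan_of_mem_Ioo hmem).continuousAt.tendsto
    have hfr : f r = 0 := by simp [f, hr.eq_zero]
    have hf : Tendsto f (𝓝 r) (𝓝 (f r)) :=
      (hasDerivAt_eval_mul_gaussian p r).continuousAt.tendsto
    rw [hfr] at hf
    exact ⟨hmem, hf.comp ht⟩
  set s := insert (-(Real.pi / 2)) (insert (Real.pi / 2) (p.roots.toFinset.image Real.arctan))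
    with hs
  have hpi := Real.pi_pos
  have hcard : s.card = p.roots.toFinset.card + 2 := by
    rw [hs, Finset.card_insert_of_notMem, Finset.card_insert_of_notMem,
      Finset.card_image_of_injective _ Real.arctan_injective]
    · exact fun h => lt_irrefl _ (hroot _ h).1.2
    · rw [Finset.mem_insert, not_or]
      exact ⟨by linarith, fun h => lt_irrefl _ (hroot _ h).1.1⟩
  have hle : s.card ≤ (q.roots.toFinset.image Real.arctan).card + 1 := by
    refine Finset.card_le_of_interleaved fun x hx y hy hxy _ => ?_
    simp only [hs, Finset.mem_insert] at hx hy
    have hx' : -(Real.pi / 2) ≤ x ∧ Tendsto (fun u => f (Real.tan u)) (𝓝[>] x) (𝓝 0) := by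
      rcases hx with rfl | rfl | hx
      · exact ⟨le_rfl,
          (hf0.mono_left atBot_le_cocompact).comp Real.tendsto_tan_neg_pi_div_two⟩
      · rcases hy with rfl | rfl | hy
        · linarith
        · linarith
        · linarith [(hroot _ hy).1.2]
      · exact ⟨(hroot _ hx).1.1.le, (hroot _ hx).2.mono_left nhdsWithin_le_nhds⟩
    have hy' : y ≤ Real.pi / 2 ∧ Tendsto (fun u => f (Real.tan u)) (𝓝[<] y) (𝓝 0) := by
      rcases hy with rfl | rfl | hy
      · linarith [hx'.1]
      · exact ⟨le_rfl, (hf0.mono_left atTop_le_cocompact).comp Real.tendsto_tan_pi_div_two⟩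
      · exact ⟨(hroot _ hy).1.2.le, (hroot _ hy).2.mono_left nhdsWithin_le_nhds⟩
    have hsub : Ioo x y ⊆ Ioo (-(Real.pi / 2)) (Real.pi / 2) := Ioo_subset_Ioo hx'.1 hy'.1
    obtain ⟨c, hc, hc0⟩ := exists_hasDerivAt_eq_zero' hxy hx'.2 hy'.2 fun u hu =>
      (hasDerivAt_eval_mul_gaussian p (Real.tan u)).comp u
        (Real.hasDerivAt_tan_of_mem_Ioo (hsub hu))
    refine ⟨c, Finset.mem_image.2 ⟨Real.tan c, ?_, Real.arctan_tan (hsub hc).1 (hsub hc).2⟩, hc⟩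
    have hcos := (Real.cos_pos_of_mem_Ioo (hsub hc)).ne'
    rw [Multiset.mem_toFinset, Polynomial.mem_roots hq]
    simpa [hq_def, hcos, Real.exp_ne_zero] using hc0
  rw [Finset.card_image_of_injective _ Real.arctan_injective] at hle
  lia

theorem qPoly_succ (k : ℕ) :
    qPoly (k + 1) = Polynomial.X * qPoly k - Polynomial.derivative (qPoly k) := by
  cases k <;> simp [qPoly]

theorem qPoly_eq_map_hermite (k : ℕ) :
    qPoly k = (Polynomial.hermite k).map (Int.castRingHom ℝ) := by
  induction k with
  | zero => simp [qPoly]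
  | succ k ih => simp [qPoly_succ, ih, Polynomial.hermite_succ, Polynomial.derivative_map]

theorem qPoly_monic (k : ℕ) : (qPoly k).Monic :=
  qPoly_eq_map_hermite k ▸ (Polynomial.hermite_monic k).map _

theorem natDegree_qPoly (k : ℕ) : (qPoly k).natDegree = k := by
  rw [qPoly_eq_map_hermite, (Polynomial.hermite_monic k).natDegree_map,
    Polynomial.natDegree_hermite]

theorem card_roots_toFinset_qPoly (k : ℕ) : (qPoly k).roots.toFinset.card = k := by
  refine le_antisymm ?_ ?_
  · exact (Multiset.toFinset_card_le _).trans
      ((Polynomial.card_roots' _).trans (natDegree_qPoly k).le)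
  · induction k with
    | zero => exact Nat.zero_le _
    | succ k ih =>
      have h := card_roots_toFinset_lt_card_roots_X_mul_sub_derivative (qPoly_monic k).ne_zero
        (qPoly_succ k ▸ (qPoly_monic (k + 1)).ne_zero)
      rw [← qPoly_succ] at h
      lia

theorem qPoly_comp_neg_X (k : ℕ) :
    (qPoly k).comp (-Polynomial.X) = (-1) ^ k * qPoly k := by
  induction k with
  | zero => simp [qPoly]
  | succ k ih =>
    have h := congrArg Polynomial.derivative ih
    have h1 : Polynomial.derivative ((-1 : Polynomial ℝ) ^ k) = 0 := by
      simp
    rw [Polynomial.derivative_comp, Polynomial.derivative_mul, h1] at h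
    simp only [Polynomial.derivative_neg, Polynomial.derivative_X] at h
    rw [qPoly_succ, Polynomial.sub_comp, Polynomial.mul_comp, Polynomial.X_comp, ih]
    linear_combination h

theorem eval_neg_qPoly (k : ℕ) (t : ℝ) :
    (qPoly k).eval (-t) = (-1) ^ k * (qPoly k).eval t := by
  simpa [Polynomial.eval_comp] using congrArg (Polynomial.eval t) (qPoly_comp_neg_X k)

/-- `q_k` has exactly `k` distinct real zeros, its zero set is symmetric
about `0`, and `q_k` is an even polynomial for even `k`, an odd polynomial for odd `k`. -/
theorem stmt10 (k : ℕ) (hk : 1 ≤ k) :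
    {t : ℝ | (qPoly k).eval t = 0}.ncard = k ∧
    (∀ t : ℝ, (qPoly k).eval t = 0 ↔ (qPoly k).eval (-t) = 0) ∧
    (Even k → ∀ t : ℝ, (qPoly k).eval (-t) = (qPoly k).eval t) ∧
    (Odd k → ∀ t : ℝ, (qPoly k).eval (-t) = -(qPoly k).eval t) := by
  refine ⟨?_, fun t => by simp [eval_neg_qPoly], fun h t => by simp [eval_neg_qPoly, h.neg_one_pow],
    fun h t => by simp [eval_neg_qPoly, h.neg_one_pow]⟩
  have h : {t : ℝ | (qPoly k).eval t = 0} = ((qPoly k).roots.toFinset : Set ℝ) := by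
    ext t
    simp [(qPoly_monic k).ne_zero]
  rw [h, Set.ncard_coe_finset, card_roots_toFinset_qPoly]
end
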